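/- arXiv:2308.10221 — 4 statements merged into one kernel-verified Lean document; each statement's English description precedes it below -/
import Mathlib

section
/- There exists a constant b1 > 0 such that there is exactly one continuously differentiable function h on (-∞,-b1) satisfying h'(s) + (n-2)·h(s) + β0·e^{-(ρ1/β0)s}·q̃(s)·h(s) = α0(n-2)/β0 for all s < -b1, where q̃(s) = η·exp(∫_{-∞}^{s} h(ρ) dρ), and such that 0 < h(s)·e^{-(ρ1/β0)s} ≤ C0/η for all s < -b1. -/
open Real Set Filter MeasureTheory

/-- `h` is a solution on `(-∞, -b1)` of the ODE
`h' + (n-2) h + β0 e^{-(ρ1/β0)s} q̃ h = α0(n-2)/β0` where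
`q̃(s) = η exp(∫_{-∞}^s h)`, satisfying `0 < h(s) e^{-(ρ1/β0)s} ≤ C0/η`. -/
def HODE (n : ℕ) (ρ1 η β0 α0 C0 b1 : ℝ) (h : ℝ → ℝ) : Prop :=
  ContDiffOn ℝ 1 h (Set.Iio (-b1)) ∧
  (∀ s < -b1, MeasureTheory.IntegrableOn h (Set.Iio s)) ∧
  (∀ s < -b1,
    deriv h s + ((n : ℝ) - 2) * h s
      + β0 * Real.exp (-(ρ1 / β0) * s) *
          (η * Real.exp (∫ ρ in Set.Iio s, h ρ)) * h s
      = α0 * ((n : ℝ) - 2) / β0) ∧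
  (∀ s < -b1, 0 < h s * Real.exp (-(ρ1 / β0) * s) ∧
    h s * Real.exp (-(ρ1 / β0) * s) ≤ C0 / η)

theorem hasDerivAt_intervalIntegral_of_continuousOn_Iio {f : ℝ → ℝ} {a c s : ℝ}
    (hf : ContinuousOn f (Iio c)) (ha : a < c) (hs : s < c) :
    HasDerivAt (fun x => ∫ t in a..x, f t) (f s) s := by
  refine intervalIntegral.integral_hasDerivAt_right ?_
    (hf.stronglyMeasurableAtFilter isOpen_Iio s hs) (hf.continuousAt (Iio_mem_nhds hs))
  refine (hf.mono fun t ht => ?_).intervalIntegrable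
  exact ht.2.trans_lt (max_lt ha hs)

theorem hasDerivAt_integral_Iio {f : ℝ → ℝ} {c s : ℝ} (hf : ContinuousOn f (Iio c))
    (hi : ∀ s < c, IntegrableOn f (Iio s)) (hs : s < c) :
    HasDerivAt (fun x => ∫ t in Iio x, f t) (f s) s := by
  refine ((hasDerivAt_intervalIntegral_of_continuousOn_Iio hf hs hs).const_add
    (∫ t in Iio s, f t)).congr_of_eventuallyEq ?_
  filter_upwards [Iio_mem_nhds hs] with x hx
  rw [← intervalIntegral.integral_Iic_sub_Iic
      ((integrableOn_Iic_iff_integrableOn_Iio enorm_ne_top).2 (hi s hs))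
      ((integrableOn_Iic_iff_integrableOn_Iio enorm_ne_top).2 (hi x hx)),
    integral_Iic_eq_integral_Iio, integral_Iic_eq_integral_Iio]
  ring

/-- The primitive of a function bounded below by `k` grows at least linearly with slope `k`. -/
theorem intervalIntegral_le_mul_sub {a : ℝ → ℝ} {k c s t : ℝ} (ha : ContinuousOn a (Iio c))
    (hk : ∀ s < c, k ≤ a s) (hs : s < c) (hts : t ≤ s) :
    ∫ x in s..t, a x ≤ k * (t - s) := by
  have hsub : uIcc t s ⊆ Iio c := fun x hx => by
    rw [uIcc_of_le hts] at hx
    exact hx.2.trans_lt hs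
  have h := intervalIntegral.integral_mono_on hts intervalIntegrable_const
    ((ha.mono hsub).intervalIntegrable (μ := volume))
    (fun x hx => hk x (hx.2.trans_lt hs))
  rw [intervalIntegral.integral_const, smul_eq_mul] at h
  rw [intervalIntegral.integral_symm]
  linarith

/-- Comparison principle from `-∞` for the linear equation `u' + a u = 0`. -/
theorem nonneg_of_deriv_add_mul_nonneg {u u' a : ℝ → ℝ} {k B c : ℝ} (hk0 : 0 < k)
    (ha : ContinuousOn a (Iio c)) (hk : ∀ s < c, k ≤ a s)
    (hu : ∀ s < c, HasDerivAt u (u' s) s) (hB : ∀ s < c, -B ≤ u s)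
    (h : ∀ s < c, 0 ≤ u' s + a s * u s) {s : ℝ} (hs : s < c) : 0 ≤ u s := by
  set P : ℝ → ℝ := fun x => ∫ t in s..x, a t with hP
  have hw : ∀ x < c, HasDerivAt (fun x => exp (P x) * u x)
      (exp (P x) * (u' x + a x * u x)) x := fun x hx => by
    refine ((hasDerivAt_intervalIntegral_of_continuousOn_Iio ha hs hx).exp.mul
      (hu x hx)).congr_deriv ?_
    simp only [hP]
    ring
  have hmono : MonotoneOn (fun x => exp (P x) * u x) (Iio c) := by
    refine monotoneOn_of_hasDerivWithinAt_nonneg (convex_Iio c)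
      (f' := fun x => exp (P x) * (u' x + a x * u x))
      (fun x hx => (hw x hx).continuousAt.continuousWithinAt) ?_ ?_
    · intro x hx
      rw [interior_Iio] at hx
      exact (hw x hx).hasDerivWithinAt
    · intro x hx
      rw [interior_Iio] at hx
      exact mul_nonneg (exp_pos _).le (h x hx)
  have hlow : ∀ t ≤ s, -(|B| * exp (k * (t - s))) ≤ u s := fun t hts => by
    have h1 := hmono (mem_Iio.2 (hts.trans_lt hs)) (mem_Iio.2 hs) hts
    simp only [hP, intervalIntegral.integral_same, exp_zero, one_mul] at h1
    have h2 := exp_le_exp.2 (intervalIntegral_le_mul_sub ha hk hs hts)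
    have h3 := hB t (hts.trans_lt hs)
    have h4 := le_abs_self B
    have h5 := exp_pos (∫ x in s..t, a x)
    nlinarith [abs_nonneg B]
  have hlim : Tendsto (fun t => -(|B| * exp (k * (t - s)))) atBot (nhds (-(|B| * 0))) := by
    refine (Tendsto.const_mul _ (tendsto_exp_atBot.comp ?_)).neg
    exact (tendsto_atBot_add_const_right _ (-s) tendsto_id).const_mul_atBot hk0
  have := le_of_tendsto hlim ((eventually_le_atBot s).mono hlow)
  simpa using this

/-- The linear equation `y' + a y = A` has a positive bounded solution on the whole line. -/
theorem exists_bounded_solution_linear {a : ℝ → ℝ} {k A : ℝ} (hk0 : 0 < k) (hA : 0 < A)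
    (ha : Continuous a) (hk : ∀ s, k ≤ a s) :
    ∃ y : ℝ → ℝ, (∀ s, HasDerivAt y (A - a s * y s) s) ∧ (∀ s, 0 < y s) ∧
      ∀ s, y s ≤ A / k := by
  set P : ℝ → ℝ := fun x => ∫ t in (0 : ℝ)..x, a t with hP
  have hPd : ∀ s, HasDerivAt P (a s) s := fun s => ha.integral_hasStrictDerivAt 0 s |>.hasDerivAt
  have hPc : Continuous P := continuous_iff_continuousAt.2 fun s => (hPd s).continuousAt
  have hle : ∀ s, ∀ t ∈ Iic s, exp (P t) ≤ exp (P s - k * s) * exp (k * t) := fun s t ht => by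
    rw [← exp_add, exp_le_exp]
    have h1 := intervalIntegral_le_mul_sub ha.continuousOn (fun x _ => hk x) (lt_add_one s) ht
    have h2 := intervalIntegral.integral_add_adjacent_intervals
      (ha.intervalIntegrable (μ := volume) 0 s) (ha.intervalIntegrable s t)
    simp only [hP]
    linarith
  have hdom : ∀ s, IntegrableOn (fun t => exp (P s - k * s) * exp (k * t)) (Iic s) := fun s =>
    (integrableOn_exp_mul_Iic hk0 s).const_mul _
  have hexpInt : ∀ s, IntegrableOn (fun t => exp (P t)) (Iic s) := fun s => by
    refine (hdom s).mono' (by fun_prop) ?_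
    filter_upwards [ae_restrict_mem measurableSet_Iic] with t ht
    rw [norm_of_nonneg (exp_pos _).le]
    exact hle s t ht
  have hexpInt' : ∀ s, IntegrableOn (fun t => exp (P t)) (Iio s) := fun s =>
    (hexpInt s).mono_set Iio_subset_Iic_self
  refine ⟨fun s => A * exp (-P s) * ∫ t in Iio s, exp (P t), fun s => ?_, fun s => ?_, fun s => ?_⟩
  · refine ((((hPd s).neg.exp).const_mul A).mul (hasDerivAt_integral_Iio (c := s + 1)
      (f := fun t => exp (P t)) (by fun_prop) (fun x _ => hexpInt' x) (lt_add_one s))).congr_deriv ?_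
    have : exp (-P s) * exp (P s) = 1 := by rw [← exp_add]; simp
    simp only [Pi.neg_apply]
    linear_combination A * this
  · refine mul_pos (mul_pos hA (exp_pos _)) ?_
    rw [setIntegral_pos_iff_support_of_nonneg_ae
      (Eventually.of_forall fun t => (exp_pos _).le) (hexpInt' s)]
    have : Function.support (fun t => exp (P t)) = univ := by
      ext t; simp [(exp_pos _).ne']
    simp [this]
  · have h1 := setIntegral_mono_on (hexpInt s) (hdom s) measurableSet_Iic (hle s)
    rw [integral_const_mul, integral_exp_mul_Iic hk0, integral_Iic_eq_integral_Iio] at h1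
    have h2 : exp (P s - k * s) * (exp (k * s) / k) = exp (P s) / k := by
      rw [← mul_div_assoc, ← exp_add]; congr 2; ring
    rw [h2] at h1
    calc A * exp (-P s) * ∫ t in Iio s, exp (P t) ≤ A * exp (-P s) * (exp (P s) / k) := by gcongr
      _ = A / k := by
        rw [exp_neg]; field_simp

theorem abs_exp_sub_exp_le {x y M : ℝ} (hx : x ≤ M) (hy : y ≤ M) :
    |exp x - exp y| ≤ exp M * |x - y| := by
  have key : ∀ x y : ℝ, x ≤ M → exp x - exp y ≤ exp M * |x - y| := fun x y hx => by
    have h1 := add_one_le_exp (y - x)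
    have h2 : exp y = exp x * exp (y - x) := by rw [← exp_add]; congr 1; ring
    have h3 : exp x * |x - y| ≤ exp M * |x - y| := by gcongr
    have h4 := le_abs_self (x - y)
    have h5 := exp_pos x
    nlinarith
  rw [abs_le]
  have := key y x hy
  rw [abs_sub_comm] at this
  exact ⟨by linarith, key x y hx⟩

/-- `h` is continuous on `(-∞, c)` with `0 ≤ h s ≤ C e^{L s}` there. -/
structure ExpBounded (C L c : ℝ) (h : ℝ → ℝ) : Prop where
  cont : ContinuousOn h (Iio c)
  nonneg : ∀ s < c, 0 ≤ h s
  le : ∀ s < c, h s ≤ C * exp (L * s)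

/-- The coefficient of the linear equation obtained by freezing the nonlocal term at `h`. -/
noncomputable def drift (k D L : ℝ) (h : ℝ → ℝ) (s : ℝ) : ℝ :=
  k + D * exp (-L * s) * exp (∫ t in Iio s, h t)

namespace ExpBounded

variable {k D L A C c s δ : ℝ} {h h₁ h₂ y₁ y₂ : ℝ → ℝ}

theorem integrableOn_exp_Iio (hL : 0 < L) (C s : ℝ) :
    IntegrableOn (fun t => C * exp (L * t)) (Iio s) :=
  ((integrableOn_exp_mul_Iic hL s).mono_set Iio_subset_Iic_self).const_mul C

theorem integral_exp_Iio (hL : 0 < L) (C s : ℝ) :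
    ∫ t in Iio s, C * exp (L * t) = C / L * exp (L * s) := by
  rw [integral_const_mul, ← integral_Iic_eq_integral_Iio, integral_exp_mul_Iic hL]
  ring

theorem integrableOn (hh : ExpBounded C L c h) (hL : 0 < L) (hs : s ≤ c) :
    IntegrableOn h (Iio s) := by
  refine (integrableOn_exp_Iio hL C s).mono'
    ((hh.cont.mono (Iio_subset_Iio hs)).aestronglyMeasurable measurableSet_Iio) ?_
  filter_upwards [ae_restrict_mem measurableSet_Iio] with t ht
  rw [norm_of_nonneg (hh.nonneg t (lt_of_lt_of_le ht hs))]
  exact hh.le t (lt_of_lt_of_le ht hs)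

theorem integral_nonneg (hh : ExpBounded C L c h) (hs : s ≤ c) : 0 ≤ ∫ t in Iio s, h t :=
  setIntegral_nonneg measurableSet_Iio fun t ht => hh.nonneg t (lt_of_lt_of_le ht hs)

theorem integral_le (hh : ExpBounded C L c h) (hL : 0 < L) (hs : s ≤ c) :
    ∫ t in Iio s, h t ≤ C / L * exp (L * s) := by
  rw [← integral_exp_Iio hL]
  exact setIntegral_mono_on (hh.integrableOn hL hs) (integrableOn_exp_Iio hL C s)
    measurableSet_Iio fun t ht => hh.le t (lt_of_lt_of_le ht hs)

theorem abs_integral_sub_le (hh₁ : ExpBounded C L c h₁) (hh₂ : ExpBounded C L c h₂)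
    (hL : 0 < L) (hδ : ∀ s < c, |h₁ s - h₂ s| ≤ δ * exp (L * s)) (hs : s ≤ c) :
    |(∫ t in Iio s, h₁ t) - ∫ t in Iio s, h₂ t| ≤ δ / L * exp (L * s) := by
  rw [← integral_sub (hh₁.integrableOn hL hs) (hh₂.integrableOn hL hs), ← integral_exp_Iio hL]
  rw [← Real.norm_eq_abs]
  refine norm_integral_le_of_norm_le (integrableOn_exp_Iio hL δ s) ?_
  filter_upwards [ae_restrict_mem measurableSet_Iio] with t ht
  exact hδ t (lt_of_lt_of_le ht hs)

theorem continuousOn_drift (hh : ExpBounded C L c h) (hL : 0 < L) :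
    ContinuousOn (drift k D L h) (Iio c) := by
  have : ContinuousOn (fun s => ∫ t in Iio s, h t) (Iio c) := fun s hs =>
    (hasDerivAt_integral_Iio hh.cont (fun x hx => hh.integrableOn hL hx.le)
      hs).continuousAt.continuousWithinAt
  unfold drift
  fun_prop

theorem add_le_drift (hh : ExpBounded C L c h) (hD : 0 < D) (hs : s ≤ c) :
    k + D * exp (-L * s) ≤ drift k D L h s := by
  have h1 := one_le_exp (hh.integral_nonneg hs)
  have h2 : 0 < D * exp (-L * s) := by positivity
  unfold drift
  nlinarith

theorem le_drift (hh : ExpBounded C L c h) (hD : 0 < D) (hs : s ≤ c) :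
    k ≤ drift k D L h s := by
  have h1 := hh.add_le_drift (k := k) hD hs
  have h2 : 0 < D * exp (-L * s) := by positivity
  linarith

theorem le_drift_mul_exp (hh : ExpBounded C L c h) (hk : 0 < k) (hD : 0 < D) (hs : s ≤ c) :
    D ≤ drift k D L h s * exp (L * s) := by
  have h1 := hh.add_le_drift (k := k) hD hs
  have h2 : exp (-L * s) * exp (L * s) = 1 := by rw [← exp_add]; simp
  have h3 := exp_pos (L * s)
  have h4 : 0 < k * exp (L * s) := by positivity
  nlinarith

theorem abs_drift_sub_le (hh₁ : ExpBounded C L c h₁) (hh₂ : ExpBounded C L c h₂) (hC : 0 < C)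
    (hL : 0 < L) (hD : 0 < D) (hc : c ≤ 0) (hδ : ∀ s < c, |h₁ s - h₂ s| ≤ δ * exp (L * s))
    (hs : s ≤ c) :
    |drift k D L h₁ s - drift k D L h₂ s| ≤ D * exp (C / L) * (δ / L) := by
  have hM : C / L * exp (L * s) ≤ C / L := by
    refine mul_le_of_le_one_right (by positivity) (exp_le_one_iff.2 ?_)
    nlinarith
  have h1 := abs_exp_sub_exp_le ((hh₁.integral_le hL hs).trans hM)
    ((hh₂.integral_le hL hs).trans hM)
  have h2 := hh₁.abs_integral_sub_le hh₂ hL hδ hs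
  have h3 : exp (-L * s) * exp (L * s) = 1 := by rw [← exp_add]; simp
  have h4 : drift k D L h₁ s - drift k D L h₂ s = D * exp (-L * s) *
      (exp (∫ t in Iio s, h₁ t) - exp (∫ t in Iio s, h₂ t)) := by unfold drift; ring
  rw [h4, abs_mul, abs_of_pos (by positivity)]
  calc _ ≤ D * exp (-L * s) * (exp (C / L) * (δ / L * exp (L * s))) := by
        gcongr
        exact h1.trans (by gcongr)
    _ = D * exp (C / L) * (δ / L) * (exp (-L * s) * exp (L * s)) := by ring
    _ = _ := by rw [h3, mul_one]

theorem sub_le_half (hh₁ : ExpBounded C L c h₁) (hh₂ : ExpBounded C L c h₂)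
    (hy₁ : ExpBounded C L c y₁) (hy₂ : ExpBounded C L c y₂) (hk : 0 < k) (hC : 0 < C)
    (hL : 0 < L) (hD : 0 < D) (hc : c ≤ 0) (hsmall : exp (C / L) * C * exp (L * c) / L ≤ 1 / 2)
    (hd₁ : ∀ s < c, HasDerivAt y₁ (A - drift k D L h₁ s * y₁ s) s)
    (hd₂ : ∀ s < c, HasDerivAt y₂ (A - drift k D L h₂ s * y₂ s) s) (hδ0 : 0 ≤ δ)
    (hδ : ∀ s < c, |h₁ s - h₂ s| ≤ δ * exp (L * s)) (hs : s < c) :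
    y₁ s - y₂ s ≤ δ / 2 * exp (L * s) := by
  have hexp : ∀ s : ℝ, HasDerivAt (fun s => δ / 2 * exp (L * s)) (δ / 2 * (exp (L * s) * L)) s :=
    fun s => ((hasDerivAt_const_mul L).exp).const_mul _
  rw [← sub_nonneg]
  refine nonneg_of_deriv_add_mul_nonneg (u := fun s => δ / 2 * exp (L * s) - (y₁ s - y₂ s))
    (B := C) hk (hh₁.continuousOn_drift (D := D) hL)
    (fun s hs => hh₁.le_drift hD hs.le) (fun s hs => (hexp s).sub ((hd₁ s hs).sub (hd₂ s hs)))
    (fun s hs => ?_) (fun s hs => ?_) hs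
  · have h1 := hy₁.le s hs
    have h2 := hy₂.nonneg s hs
    have h3 : exp (L * s) ≤ 1 := exp_le_one_iff.2 (by nlinarith)
    have h4 : 0 ≤ δ / 2 * exp (L * s) := by positivity
    nlinarith
  · have h1 := hh₁.le_drift_mul_exp hk hD hs.le
    have h2 := hh₁.abs_drift_sub_le (k := k) hh₂ hC hL hD hc hδ hs.le
    have h3 : y₂ s ≤ C * exp (L * c) := (hy₂.le s hs).trans (by gcongr)
    have h4 : |drift k D L h₁ s - drift k D L h₂ s| * y₂ s ≤ D * δ / 2 := by
      calc _ ≤ D * exp (C / L) * (δ / L) * (C * exp (L * c)) :=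
            mul_le_mul h2 h3 (hy₂.nonneg s hs) (by positivity)
        _ = D * δ * (exp (C / L) * C * exp (L * c) / L) := by ring
        _ ≤ D * δ * (1 / 2) := by gcongr
        _ = _ := by ring
    have h5 := neg_abs_le (drift k D L h₁ s - drift k D L h₂ s)
    have h6 := mul_le_mul_of_nonneg_right h5 (hy₂.nonneg s hs)
    have h7 : 0 ≤ δ / 2 * (exp (L * s) * L) := by positivity
    have h8 := mul_le_mul_of_nonneg_left h1 hδ0
    nlinarith

/-- The solution operator of the frozen linear equation is a contraction near `-∞`. -/
theorem abs_sub_le_half (hh₁ : ExpBounded C L c h₁) (hh₂ : ExpBounded C L c h₂)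
    (hy₁ : ExpBounded C L c y₁) (hy₂ : ExpBounded C L c y₂) (hk : 0 < k) (hC : 0 < C)
    (hL : 0 < L) (hD : 0 < D) (hc : c ≤ 0) (hsmall : exp (C / L) * C * exp (L * c) / L ≤ 1 / 2)
    (hd₁ : ∀ s < c, HasDerivAt y₁ (A - drift k D L h₁ s * y₁ s) s)
    (hd₂ : ∀ s < c, HasDerivAt y₂ (A - drift k D L h₂ s * y₂ s) s) (hδ0 : 0 ≤ δ)
    (hδ : ∀ s < c, |h₁ s - h₂ s| ≤ δ * exp (L * s)) (hs : s < c) :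
    |y₁ s - y₂ s| ≤ δ / 2 * exp (L * s) := by
  rw [abs_le]
  have h1 := sub_le_half hh₁ hh₂ hy₁ hy₂ hk hC hL hD hc hsmall hd₁ hd₂ hδ0 hδ hs
  have h2 := sub_le_half hh₂ hh₁ hy₂ hy₁ hk hC hL hD hc hsmall hd₂ hd₁ hδ0
    (fun s hs => by rw [abs_sub_comm]; exact hδ s hs) hs
  exact ⟨by linarith, h1⟩

/-- The frozen linear equation has a positive solution obeying the same exponential bound. -/
theorem exists_linear_solution (hh : ∀ c, ExpBounded C L c h) (hk : 0 < k) (hC : 0 < C)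
    (hL : 0 < L) (hD : 0 < D) :
    ∃ y : ℝ → ℝ, (∀ s, HasDerivAt y (C * D - drift k D L h s * y s) s) ∧ (∀ s, 0 < y s) ∧
      ∀ s, y s ≤ C * exp (L * s) := by
  have hcont : Continuous (drift k D L h) := continuous_iff_continuousAt.2 fun s =>
    ((hh (s + 1)).continuousOn_drift hL).continuousAt (Iio_mem_nhds (lt_add_one s))
  obtain ⟨y, hd, hpos, hle⟩ := exists_bounded_solution_linear hk (mul_pos hC hD) hcont
    (fun s => (hh s).le_drift hD le_rfl)
  refine ⟨y, hd, hpos, fun s => ?_⟩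
  have hexp : ∀ s : ℝ, HasDerivAt (fun s => C * exp (L * s)) (C * (exp (L * s) * L)) s :=
    fun s => ((hasDerivAt_const_mul L).exp).const_mul _
  rw [← sub_nonneg]
  refine nonneg_of_deriv_add_mul_nonneg (u := fun s => C * exp (L * s) - y s)
    (B := C * D / k) (c := s + 1) hk hcont.continuousOn (fun s _ => (hh s).le_drift hD le_rfl)
    (fun s _ => (hexp s).sub (hd s)) (fun s _ => ?_) (fun s _ => ?_) (lt_add_one s)
  · have h1 := hle s
    have h2 : 0 < C * exp (L * s) := by positivity
    linarith
  · have h1 := mul_le_mul_of_nonneg_left ((hh s).le_drift_mul_exp hk hD le_rfl) hC.le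
    have h2 : 0 ≤ C * (exp (L * s) * L) := by positivity
    linarith

/-- Two solutions of the nonlocal equation coincide near `-∞`. -/
theorem eqOn_of_hasDerivAt (hh₁ : ExpBounded C L c h₁) (hh₂ : ExpBounded C L c h₂) (hk : 0 < k)
    (hC : 0 < C) (hL : 0 < L) (hD : 0 < D) (hc : c ≤ 0)
    (hsmall : exp (C / L) * C * exp (L * c) / L ≤ 1 / 2)
    (hd₁ : ∀ s < c, HasDerivAt h₁ (A - drift k D L h₁ s * h₁ s) s)
    (hd₂ : ∀ s < c, HasDerivAt h₂ (A - drift k D L h₂ s * h₂ s) s) : EqOn h₁ h₂ (Iio c) := by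
  have key : ∀ m : ℕ, ∀ s < c, |h₁ s - h₂ s| ≤ C * (1 / 2) ^ m * exp (L * s) := fun m => by
    induction m with
    | zero =>
      intro s hs
      rw [abs_le]
      constructor <;> linarith [hh₁.nonneg s hs, hh₂.nonneg s hs, hh₁.le s hs, hh₂.le s hs]
    | succ m ih =>
      intro s hs
      have := abs_sub_le_half hh₁ hh₂ hh₁ hh₂ hk hC hL hD hc hsmall hd₁ hd₂ (by positivity) ih hs
      rw [pow_succ]
      linarith
  intro s hs
  have hlim : Tendsto (fun m : ℕ => C * (1 / 2 : ℝ) ^ m * exp (L * s)) atTop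
      (nhds (C * 0 * exp (L * s))) :=
    ((tendsto_pow_atTop_nhds_zero_of_lt_one (by norm_num) (by norm_num)).const_mul C).mul_const _
  have := ge_of_tendsto' hlim fun m => key m s hs
  rw [mul_zero, zero_mul] at this
  exact sub_eq_zero.1 (abs_nonpos_iff.1 this)

open BoundedContinuousFunction in
/-- The nonlocal equation has a positive solution near `-∞`. -/
theorem exists_solution (hk : 0 < k) (hC : 0 < C) (hL : 0 < L) (hD : 0 < D) (hc : c ≤ 0)
    (hsmall : exp (C / L) * C * exp (L * c) / L ≤ 1 / 2) :
    ∃ y : ℝ → ℝ, ContDiff ℝ 1 y ∧ (∀ s, 0 < y s) ∧ (∀ s, y s ≤ C * exp (L * s)) ∧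
      ∀ s < c, HasDerivAt y (C * D - drift k D L y s * y s) s := by
  set H : (ℝ →ᵇ ℝ) → ℝ → ℝ := fun g s => max 0 (min C (g s)) * exp (L * s) with hH
  have hbdd : ∀ g c, ExpBounded C L c (H g) := fun g c =>
    ⟨by fun_prop, fun s _ => by positivity, fun s _ => by
      simp only [hH]
      gcongr
      exact max_le hC.le (min_le_left _ _)⟩
  have hsub : ∀ g₁ g₂ s, |H g₁ s - H g₂ s| ≤ dist g₁ g₂ * exp (L * s) := fun g₁ g₂ s => by
    simp only [hH]
    rw [← sub_mul, abs_mul, abs_of_pos (exp_pos _)]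
    gcongr
    refine le_trans ?_ (dist_coe_le_dist (f := g₁) (g := g₂) s)
    rw [Real.dist_eq]
    refine (abs_max_sub_max_le_max _ _ _ _).trans (max_le (by simp) ?_)
    exact (abs_min_sub_min_le_max _ _ _ _).trans (max_le (by simp) le_rfl)
  choose Y hYd hYpos hYle using fun g => exists_linear_solution (hbdd g) hk hC hL hD
  have hYc : ∀ g, Continuous (Y g) := fun g =>
    continuous_iff_continuousAt.2 fun s => (hYd g s).continuousAt
  have hcancel : ∀ s, exp (L * s) * exp (-(L * s)) = 1 := fun s => by rw [← exp_add]; simp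
  set T : (ℝ →ᵇ ℝ) → (ℝ →ᵇ ℝ) := fun g => ofNormedAddCommGroup
    (fun s => Y g (min s c) * exp (-(L * min s c)))
    (by have := hYc g; fun_prop) C (fun s => by
      rw [norm_of_nonneg (mul_nonneg (hYpos g _).le (exp_pos _).le)]
      calc _ ≤ C * exp (L * min s c) * exp (-(L * min s c)) := by
            gcongr
            exact hYle g _
        _ = C := by rw [mul_assoc, hcancel, mul_one]) with hT
  have hYsub : ∀ g₁ g₂, ∀ s ≤ c, |Y g₁ s - Y g₂ s| ≤ dist g₁ g₂ / 2 * exp (L * s) := by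
    intro g₁ g₂
    have hlt : ∀ s < c, |Y g₁ s - Y g₂ s| ≤ dist g₁ g₂ / 2 * exp (L * s) := fun s hs =>
      abs_sub_le_half (hbdd g₁ c) (hbdd g₂ c)
        ⟨(hYc g₁).continuousOn, fun s _ => (hYpos g₁ s).le, fun s _ => hYle g₁ s⟩
        ⟨(hYc g₂).continuousOn, fun s _ => (hYpos g₂ s).le, fun s _ => hYle g₂ s⟩
        hk hC hL hD hc hsmall (fun s _ => hYd g₁ s) (fun s _ => hYd g₂ s) dist_nonneg
        (fun s _ => hsub g₁ g₂ s) hs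
    have hclosed : IsClosed {s | |Y g₁ s - Y g₂ s| ≤ dist g₁ g₂ / 2 * exp (L * s)} := by
      have := hYc g₁
      have := hYc g₂
      exact isClosed_le (by fun_prop) (by fun_prop)
    intro s hs
    have : closure (Iio c) ⊆ _ := closure_minimal hlt hclosed
    rw [closure_Iio] at this
    exact this hs
  have hTc : ContractingWith (1 / 2) T := by
    refine ⟨by rw [← NNReal.coe_lt_coe]; norm_num, LipschitzWith.of_dist_le_mul fun g₁ g₂ => ?_⟩
    rw [dist_le (by positivity)]
    intro s
    simp only [hT, coe_ofNormedAddCommGroup]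
    rw [Real.dist_eq, ← sub_mul, abs_mul, abs_of_pos (exp_pos _)]
    calc _ ≤ dist g₁ g₂ / 2 * exp (L * min s c) * exp (-(L * min s c)) := by
          gcongr
          exact hYsub g₁ g₂ _ (min_le_right _ _)
      _ = _ := by
        rw [mul_assoc, hcancel]
        push_cast
        ring
  set g := hTc.fixedPoint
  have hfix : ∀ s ≤ c, g s = Y g s * exp (-(L * s)) := fun s hs => by
    have h1 : T g = g := hTc.fixedPoint_isFixedPt
    have h2 : T g s = Y g (min s c) * exp (-(L * min s c)) := rfl
    rwa [h1, min_eq_left hs] at h2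
  have hHY : ∀ s ≤ c, H g s = Y g s := fun s hs => by
    have h1 : 0 ≤ g s := by
      rw [hfix s hs]
      exact (mul_pos (hYpos g s) (exp_pos _)).le
    have h2 : g s ≤ C := by
      rw [hfix s hs]
      calc _ ≤ C * exp (L * s) * exp (-(L * s)) := by
            gcongr
            exact hYle g s
        _ = C := by rw [mul_assoc, hcancel, mul_one]
    simp only [hH]
    rw [min_eq_right h2, max_eq_right h1, hfix s hs, mul_assoc, mul_comm (exp _), hcancel, mul_one]
  refine ⟨Y g, ?_, hYpos g, hYle g, fun s hs => ?_⟩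
  · refine contDiff_one_iff_deriv.2 ⟨fun s => (hYd g s).differentiableAt, ?_⟩
    have h1 : deriv (Y g) = fun s => C * D - drift k D L (H g) s * Y g s :=
      funext fun s => (hYd g s).deriv
    have h2 : Continuous (drift k D L (H g)) := continuous_iff_continuousAt.2 fun s =>
      ((hbdd g (s + 1)).continuousOn_drift hL).continuousAt (Iio_mem_nhds (lt_add_one s))
    have h3 := hYc g
    rw [h1]
    fun_prop
  · have h1 : ∫ t in Iio s, H g t = ∫ t in Iio s, Y g t :=
      setIntegral_congr_fun measurableSet_Iio fun t ht => hHY t (ht.le.trans hs.le)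
    have h2 : drift k D L (H g) s = drift k D L (Y g) s := by simp only [drift, h1]
    rw [← h2]
    exact hYd g s

end ExpBounded

theorem exists_neg_mul_exp_le (K : ℝ) {L : ℝ} (hL : 0 < L) :
    ∃ c < 0, K * exp (L * c) / L ≤ 1 / 2 := by
  have hlim : Tendsto (fun c => K * exp (L * c) / L) atBot (nhds (K * 0 / L)) :=
    ((tendsto_exp_atBot.comp (tendsto_id.const_mul_atBot hL)).const_mul K).div_const L
  rw [mul_zero, zero_div] at hlim
  obtain ⟨c, h1, h2⟩ :=
    ((hlim.eventually_le_const (by norm_num : (0 : ℝ) < 1 / 2)).and (eventually_lt_atBot 0)).exists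
  exact ⟨c, h2, h1⟩

theorem stmt11 (n : ℕ) (η ρ1 β0 α0 C0 : ℝ)
    (hn : 3 ≤ n) (hη : 0 < η) (hρ1 : 0 < ρ1) (hβ0 : 0 < β0)
    (hα0 : α0 = 2 * β0 + ρ1)
    (hC0 : C0 = α0 * ((n : ℝ) - 2) / β0 ^ 2) :
    ∃ b1 : ℝ, 0 < b1 ∧
      ∃ h : ℝ → ℝ, HODE n ρ1 η β0 α0 C0 b1 h ∧
        ∀ h' : ℝ → ℝ, HODE n ρ1 η β0 α0 C0 b1 h' →
          Set.EqOn h' h (Set.Iio (-b1)) := by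
  have hn' : (3 : ℝ) ≤ n := by exact_mod_cast hn
  have hk : 0 < (n : ℝ) - 2 := by linarith
  have hL : 0 < ρ1 / β0 := by positivity
  have hD : 0 < β0 * η := by positivity
  have hα : 0 < α0 := by rw [hα0]; positivity
  have hC : 0 < C0 / η := by rw [hC0]; positivity
  have hA : C0 / η * (β0 * η) = α0 * ((n : ℝ) - 2) / β0 := by rw [hC0]; field_simp
  obtain ⟨c, hc, hsmall⟩ := exists_neg_mul_exp_le (exp (C0 / η / (ρ1 / β0)) * (C0 / η)) hL
  obtain ⟨y, hy1, hypos, hyle, hyd⟩ := ExpBounded.exists_solution hk hC hL hD hc.le hsmall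
  have hyb : ExpBounded (C0 / η) (ρ1 / β0) c y :=
    ⟨hy1.continuous.continuousOn, fun s _ => (hypos s).le, fun s _ => hyle s⟩
  have hcancel : ∀ s, exp (ρ1 / β0 * s) * exp (-(ρ1 / β0) * s) = 1 := fun s => by
    rw [← exp_add]; simp
  refine ⟨-c, by linarith, y, ?_, fun h hh => ?_⟩
  · rw [HODE, neg_neg]
    refine ⟨hy1.contDiffOn, fun s hs => hyb.integrableOn hL hs.le, fun s hs => ?_, fun s hs =>
      ⟨mul_pos (hypos s) (exp_pos _), ?_⟩⟩
    · rw [(hyd s hs).deriv, ← hA, drift]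
      ring
    · calc _ ≤ C0 / η * exp (ρ1 / β0 * s) * exp (-(ρ1 / β0) * s) := by
            gcongr
            exact hyle s
        _ = _ := by rw [mul_assoc, hcancel, mul_one]
  · rw [HODE, neg_neg] at hh
    rw [neg_neg]
    obtain ⟨h1, -, hode, hbd⟩ := hh
    have hhb : ExpBounded (C0 / η) (ρ1 / β0) c h :=
      ⟨h1.continuousOn, fun s hs => (pos_of_mul_pos_left (hbd s hs).1 (exp_pos _).le).le,
        fun s hs => by
          have h2 := mul_le_mul_of_nonneg_right (hbd s hs).2 (exp_pos (ρ1 / β0 * s)).le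
          rwa [mul_assoc, mul_comm (exp _), hcancel, mul_one] at h2⟩
    refine hhb.eqOn_of_hasDerivAt hyb hk hC hL hD hc.le hsmall (fun s hs => ?_) hyd
    refine ((h1.differentiableOn one_ne_zero).differentiableAt
      (Iio_mem_nhds hs)).hasDerivAt.congr_deriv ?_
    have h3 := hode s hs
    rw [← hA] at h3
    rw [drift]
    linear_combination h3
end

section
/- Let g be a positive function on (0,∞) such that r ↦ g'(r)/g(r) is continuously differentiable on (0,∞), (g'/g)'(r) + ((n-1)/r)·(g'(r)/g(r)) + α0·g(r) + β0·r·g'(r) = 0 for all r > 0, lim_{r→0+} r^{α0/β0}·g(r) = η, and, with q(r) = r^{α0/β0}·g(r) and h(s) = e^s·q'(e^s)/q(e^s), 0 < h(s)·e^{-(ρ1/β0)s} ≤ C0/η for all s ∈ ℝ. Then g'(r) < 0 for all r > 0. -/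
open Real Set Filter

/-- `h(s) = e^s q'(e^s) / q(e^s)` where `q(r) = r^{α0/β0} g(r)`. -/
noncomputable def Hfun (α0 β0 : ℝ) (g : ℝ → ℝ) (s : ℝ) : ℝ :=
  Real.exp s * deriv (fun r => r ^ (α0 / β0) * g r) (Real.exp s) /
    (Real.exp s ^ (α0 / β0) * g (Real.exp s))

/-- radially symmetric solution of `Δ log g + α0 g + β0 x·∇g = 0` on `(0,∞)`
with `lim_{r→0+} r^{α0/β0} g(r) = η`. -/
def LogSol (n : ℕ) (α0 β0 η : ℝ) (g : ℝ → ℝ) : Prop :=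
  (∀ r ∈ Set.Ioi (0 : ℝ), 0 < g r) ∧
  ContDiffOn ℝ 1 (fun r => deriv g r / g r) (Set.Ioi 0) ∧
  (∀ r ∈ Set.Ioi (0 : ℝ),
    deriv (fun r' => deriv g r' / g r') r
      + (((n : ℝ) - 1) / r) * (deriv g r / g r)
      + α0 * g r + β0 * r * deriv g r = 0) ∧
  Filter.Tendsto (fun r => r ^ (α0 / β0) * g r) (nhdsWithin 0 (Set.Ioi 0)) (nhds η)

/-- the bound `0 < h(s) e^{-(ρ1/β0) s} ≤ C0/η` for all `s ∈ ℝ`. -/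
def LogHBound (α0 β0 ρ1 η C0 : ℝ) (g : ℝ → ℝ) : Prop :=
  ∀ s : ℝ, 0 < Hfun α0 β0 g s * Real.exp (-(ρ1 / β0) * s) ∧
    Hfun α0 β0 g s * Real.exp (-(ρ1 / β0) * s) ≤ C0 / η

/-- If `x ↦ x ^ a * g x` is differentiable at `r > 0`, then so is `g`. -/
lemma differentiableAt_of_rpow_mul {a r : ℝ} {g : ℝ → ℝ} (hr : 0 < r)
    (hq : DifferentiableAt ℝ (fun x => x ^ a * g x) r) : DifferentiableAt ℝ g r := by
  have hp : DifferentiableAt ℝ (fun x : ℝ => x ^ (-a)) r :=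
    (Real.hasDerivAt_rpow_const (Or.inl hr.ne')).differentiableAt
  refine (hp.mul hq).congr_of_eventuallyEq ?_
  filter_upwards [lt_mem_nhds hr] with x hx
  simp only [Pi.mul_apply]
  rw [← mul_assoc, ← Real.rpow_add hx, neg_add_cancel, Real.rpow_zero, one_mul]

/-- Where it does not vanish, `h` is `α0 / β0` plus the logarithmic derivative `r g'(r) / g(r)`. -/
lemma Hfun_eq_of_ne_zero {α0 β0 s : ℝ} {g : ℝ → ℝ} (hg : 0 < g (exp s))
    (hne : Hfun α0 β0 g s ≠ 0) :
    Hfun α0 β0 g s = α0 / β0 + exp s * (deriv g (exp s) / g (exp s)) := by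
  have hr := exp_pos s
  have hd : deriv (fun r => r ^ (α0 / β0) * g r) (exp s) ≠ 0 := by
    intro h0
    exact hne (by simp [Hfun, h0])
  have hdg := differentiableAt_of_rpow_mul hr (differentiableAt_of_deriv_ne_zero hd)
  have hq := (Real.hasDerivAt_rpow_const (p := α0 / β0) (Or.inl hr.ne')).fun_mul hdg.hasDerivAt
  have hpos := Real.rpow_pos_of_pos hr (α0 / β0)
  rw [Hfun, hq.deriv, Real.rpow_sub_one hr.ne']
  field_simp

/-- If `w' + (m / r) w < 0` on `(0, ∞)`, then `r ↦ r ^ m * w r` is strictly decreasing there. -/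
lemma strictAntiOn_pow_mul {m : ℕ} {w : ℝ → ℝ} (hw : DifferentiableOn ℝ w (Ioi 0))
    (hlt : ∀ r ∈ Ioi (0 : ℝ), deriv w r + m / r * w r < 0) :
    StrictAntiOn (fun r => r ^ m * w r) (Ioi 0) := by
  refine strictAntiOn_of_deriv_neg (convex_Ioi 0)
    ((continuous_pow m).continuousOn.mul hw.continuousOn) fun r hr => ?_
  rw [interior_Ioi] at hr
  have hr' : (0 : ℝ) < r := hr
  have hd := (hw.differentiableAt (Ioi_mem_nhds hr')).hasDerivAt
  rw [((hasDerivAt_pow m r).fun_mul hd).deriv]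
  have hpow : (m : ℝ) * r ^ (m - 1) = r ^ m * (m / r) := by
    cases m with
    | zero => simp
    | succ k => rw [Nat.add_sub_cancel, pow_succ]; field_simp
  rw [hpow]
  nlinarith [mul_neg_of_pos_of_neg (pow_pos hr' m) (hlt r hr)]

theorem stmt14 (n : ℕ) (η ρ1 β0 α0 C0 : ℝ)
    (hn : 3 ≤ n) (hη : 0 < η) (hρ1 : 0 < ρ1) (hβ0 : 0 < β0)
    (hα0 : α0 = 2 * β0 + ρ1)
    (hC0 : C0 = α0 * ((n : ℝ) - 2) / β0 ^ 2)
    (g : ℝ → ℝ) (hg : LogSol n α0 β0 η g) (hh : LogHBound α0 β0 ρ1 η C0 g) :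
    ∀ r ∈ Set.Ioi (0 : ℝ), deriv g r < 0 := by
  obtain ⟨hpos, hsmooth, hode, -⟩ := hg
  have hH_pos : ∀ s, 0 < Hfun α0 β0 g s := fun s =>
    pos_of_mul_pos_left (hh s).1 (exp_pos _).le
  have hH : ∀ s, Hfun α0 β0 g s = α0 / β0 + exp s * (deriv g (exp s) / g (exp s)) := fun s =>
    Hfun_eq_of_ne_zero (hpos _ (exp_pos s)) (hH_pos s).ne'
  have hanti : StrictAntiOn (fun r => r ^ (n - 1) * (deriv g r / g r)) (Ioi 0) := by
    refine strictAntiOn_pow_mul (hsmooth.differentiableOn one_ne_zero) fun r hr => ?_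
    have hgr := hpos r hr
    have hlog := hH_pos (log r)
    rw [hH, exp_log hr] at hlog
    have hdrift : 0 < α0 * g r + β0 * r * deriv g r := by
      have h := mul_pos (mul_pos hβ0 hgr) hlog
      have heq : β0 * g r * (α0 / β0 + r * (deriv g r / g r))
          = α0 * g r + β0 * r * deriv g r := by field_simp
      rwa [heq] at h
    rw [Nat.cast_sub (by lia), Nat.cast_one]
    linarith [hode r hr]
  intro r hr
  have hlim : Tendsto (fun s => C0 / η * exp (ρ1 / β0 * s)) atBot (nhds 0) := by
    simpa using (tendsto_exp_atBot.comp
      (tendsto_id.const_mul_atBot (div_pos hρ1 hβ0))).const_mul (C0 / η)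
  have hα : 0 < α0 / β0 := div_pos (by linarith) hβ0
  obtain ⟨s, hs, hsr⟩ :=
    ((hlim.eventually_lt_const hα).and (eventually_lt_atBot (log r))).exists
  have hHs : Hfun α0 β0 g s ≤ C0 / η * exp (ρ1 / β0 * s) := by
    have h := (hh s).2
    rwa [neg_mul, exp_neg, ← div_eq_mul_inv, div_le_iff₀ (exp_pos _)] at h
  have hneg : deriv g (exp s) / g (exp s) < 0 := by
    rw [hH] at hHs
    exact neg_of_mul_neg_right (show exp s * _ < 0 by linarith) (exp_pos s).le
  have hlt := hanti (exp_pos s) hr ((lt_log_iff_exp_lt hr).1 hsr)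
  have hr_neg : deriv g r / g r < 0 :=
    neg_of_mul_neg_right (hlt.trans (mul_neg_of_pos_of_neg (pow_pos (exp_pos s) _) hneg))
      (pow_pos hr _).le
  simpa using (div_lt_iff₀ (hpos r hr)).1 hr_neg
end

section
/- Set β1 = ρ1/(n-2-nm) and assume β > β1. Let f be a positive function on (0,∞) such that r ↦ f(r)^m/m is twice continuously differentiable on (0,∞), (f^m/m)''(r) + ((n-1)/r)·(f^m/m)'(r) + α·f(r) + β·r·f'(r) = 0 for all r > 0, and lim_{r→0+} r^{α/β}·f(r) = η. Then lim_{r→∞} r²·f(r)^{1-m} = 2(n-2-nm)/((1-m)·ρ1). -/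
open Real Set Filter

/-- radially symmetric solution of `Δ(f^m/m) + α f + β x·∇f = 0` on `(0,∞)`
with `lim_{r→0+} r^{α/β} f(r) = η`. -/
def FDESol (n : ℕ) (m α β η : ℝ) (f : ℝ → ℝ) : Prop :=
  (∀ r ∈ Set.Ioi (0 : ℝ), 0 < f r) ∧
  ContDiffOn ℝ 2 (fun r => f r ^ m / m) (Set.Ioi 0) ∧
  (∀ r ∈ Set.Ioi (0 : ℝ),
    deriv (deriv (fun r' => f r' ^ m / m)) r
      + (((n : ℝ) - 1) / r) * deriv (fun r' => f r' ^ m / m) r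
      + α * f r + β * r * deriv f r = 0) ∧
  Filter.Tendsto (fun r => r ^ (α / β) * f r) (nhdsWithin 0 (Set.Ioi 0)) (nhds η)

theorem hasDerivAt_exp_const_mul (a s : ℝ) :
    HasDerivAt (fun t => exp (a * t)) (a * exp (a * s)) s :=
  (((hasDerivAt_id s).const_mul a).exp).congr_deriv (by simp; ring)

/-- A damped oscillator `p'' + D p' + G = 0` with potential `V`, where `V' = G p'` and `G' = K p'`:
if the damping is bounded below and everything is bounded, the force `G` tends to zero. -/
theorem tendsto_force_zero_of_damped {q D G V K : ℝ → ℝ} {S M : ℝ}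
    (hq : ∀ s, HasDerivAt q (-D s * q s - G s) s)
    (hV : ∀ s, HasDerivAt V (G s * q s) s)
    (hG : ∀ s, HasDerivAt G (K s * q s) s)
    (hD : ∀ s, S ≤ s → 1 ≤ D s) (hDM : ∀ s, S ≤ s → D s ≤ M)
    (hGM : ∀ s, S ≤ s → |G s| ≤ M) (hKM : ∀ s, S ≤ s → |K s| ≤ M)
    (hVM : ∀ s, S ≤ s → -M ≤ V s) :
    Tendsto G atTop (nhds 0) := by
  have hM1 : 1 ≤ M := (hD S le_rfl).trans (hDM S le_rfl)
  have hE : ∀ s, HasDerivAt (fun t => q t ^ 2 / 2 + V t) (-D s * q s ^ 2) s := fun s =>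
    ((((hq s).pow 2).div_const 2).add (hV s)).congr_deriv (by simp; ring)
  have hEanti : AntitoneOn (fun t => q t ^ 2 / 2 + V t) (Ici S) := by
    refine antitoneOn_of_deriv_nonpos (convex_Ici S)
      (fun s _ => (hE s).continuousAt.continuousWithinAt)
      (fun s _ => (hE s).differentiableAt.differentiableWithinAt) fun s hs => ?_
    rw [interior_Ici] at hs
    rw [(hE s).deriv]
    nlinarith [hD s (le_of_lt hs), sq_nonneg (q s)]
  obtain ⟨B, hB1, hqB⟩ : ∃ B, 1 ≤ B ∧ ∀ s, S ≤ s → |q s| ≤ B := by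
    refine ⟨1 + 2 * |q S ^ 2 / 2 + V S + M|, by nlinarith [abs_nonneg (q S ^ 2 / 2 + V S + M)],
      fun s hs => ?_⟩
    have h1 := hEanti self_mem_Ici hs hs
    have h2 := hVM s hs
    simp only at h1
    have h3 := le_abs_self (q S ^ 2 / 2 + V S + M)
    refine abs_le_of_sq_le_sq ?_ (by positivity)
    nlinarith [abs_nonneg (q S ^ 2 / 2 + V S + M)]
  set ε : ℝ := 1 / (M ^ 2 + 2 * M + 1) with hε
  have hden : 0 < M ^ 2 + 2 * M + 1 := by positivity
  have hε0 : 0 < ε := by positivity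
  have hεM : ε * (M ^ 2 + 2 * M + 1) = 1 := by rw [hε]; field_simp
  have hF : ∀ s, HasDerivAt (fun t => q t ^ 2 / 2 + V t + ε * (q t * G t))
      (-D s * q s ^ 2 + ε * ((-D s * q s - G s) * G s + q s * (K s * q s))) s := fun s =>
    (hE s).add (((hq s).mul (hG s)).const_mul ε)
  have hFle : ∀ s, S ≤ s →
      -D s * q s ^ 2 + ε * ((-D s * q s - G s) * G s + q s * (K s * q s)) ≤ -(ε / 2) * G s ^ 2 := by
    intro s hs
    have h1 := hD s hs
    have h2 := hDM s hs
    have h3 := (abs_le.mp (hKM s hs)).2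
    have h4 : D s ^ 2 ≤ M ^ 2 := by gcongr
    have h5 : 0 ≤ ε * (D s * q s + G s) ^ 2 := by positivity
    have h6 : ε * (K s * q s ^ 2) ≤ ε * (M * q s ^ 2) := by gcongr
    have h7 : ε * (D s ^ 2 * q s ^ 2) ≤ ε * (M ^ 2 * q s ^ 2) := by gcongr
    have h8 : q s ^ 2 ≤ D s * q s ^ 2 := by nlinarith [sq_nonneg (q s)]
    have h9 : ε * (M ^ 2 + 2 * M + 1) * q s ^ 2 = q s ^ 2 := by rw [hεM, one_mul]
    have h10 : 0 ≤ ε * q s ^ 2 := by positivity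
    nlinarith
  set F : ℝ → ℝ := fun t => q t ^ 2 / 2 + V t + ε * (q t * G t) with hFdef
  have hFanti : AntitoneOn F (Ici S) := by
    refine antitoneOn_of_deriv_nonpos (convex_Ici S)
      (fun s _ => (hF s).continuousAt.continuousWithinAt)
      (fun s _ => (hF s).differentiableAt.differentiableWithinAt) fun s hs => ?_
    rw [interior_Ici] at hs
    rw [(hF s).deriv]
    have := hFle s (le_of_lt hs)
    have : 0 ≤ ε / 2 * G s ^ 2 := by positivity
    linarith
  have hFbdd : ∀ s, S ≤ s → -M - ε * (B * M) ≤ F s := by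
    intro s hs
    have h1 : |q s * G s| ≤ B * M := by
      rw [abs_mul]
      exact mul_le_mul (hqB s hs) (hGM s hs) (abs_nonneg _) (by linarith)
    have h2 : ε * (-(B * M)) ≤ ε * (q s * G s) :=
      mul_le_mul_of_nonneg_left (abs_le.mp h1).1 hε0.le
    have h3 := hVM s hs
    simp only [hFdef]
    nlinarith [sq_nonneg (q s)]
  obtain ⟨l, hl⟩ : ∃ l, Tendsto F atTop (nhds l) := by
    have hanti : Antitone fun t => F (max S t) := fun a b hab =>
      hFanti (mem_Ici.mpr (le_max_left _ _)) (mem_Ici.mpr (le_max_left _ _)) (max_le_max le_rfl hab)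
    refine ⟨_, (tendsto_atTop_ciInf hanti
      ⟨-M - ε * (B * M), ?_⟩).congr' ?_⟩
    · rintro _ ⟨t, rfl⟩
      exact hFbdd _ (le_max_left _ _)
    · filter_upwards [eventually_ge_atTop S] with t ht
      rw [max_eq_right ht]
  rw [Metric.tendsto_atTop]
  intro δ hδ
  set h : ℝ := δ / (2 * (M * B)) with hh
  have hMB : 0 < M * B := by positivity
  have hh0 : 0 < h := by positivity
  have hhMB : M * B * h = δ / 2 := by rw [hh]; field_simp
  have hdiff : Tendsto (fun s => F s - F (s + h)) atTop (nhds 0) := by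
    simpa using hl.sub (hl.comp (tendsto_atTop_add_const_right _ h tendsto_id))
  have hev : ∀ᶠ s in atTop, F s - F (s + h) < ε / 2 * (δ / 2) ^ 2 * h :=
    hdiff.eventually_lt_const (by positivity)
  obtain ⟨N, hN⟩ := eventually_atTop.mp (hev.and (eventually_ge_atTop S))
  refine ⟨N, fun s hs => ?_⟩
  obtain ⟨h1, hSs⟩ := hN s hs
  obtain ⟨ξ, hξ, hξ'⟩ := exists_hasDerivAt_eq_slope F _ (lt_add_of_pos_right s hh0)
    (fun t _ => (hF t).continuousAt.continuousWithinAt) (fun t _ => hF t)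
  have hSξ : S ≤ ξ := hSs.trans hξ.1.le
  have h2 := hFle ξ hSξ
  rw [hξ', div_le_iff₀ (by linarith)] at h2
  have h3 : G ξ ^ 2 < (δ / 2) ^ 2 := by
    have : ε / 2 * h * G ξ ^ 2 < ε / 2 * h * (δ / 2) ^ 2 := by nlinarith
    exact lt_of_mul_lt_mul_left this (by positivity)
  have h4 : |G ξ| < δ / 2 := abs_lt_of_sq_lt_sq h3 (by positivity)
  have h5 : ‖G ξ - G s‖ ≤ M * B * ‖ξ - s‖ := by
    refine (convex_Ici S).norm_image_sub_le_of_norm_hasDerivWithin_le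
      (fun t _ => (hG t).hasDerivWithinAt) (fun t ht => ?_) hSs hSξ
    rw [norm_mul]
    exact mul_le_mul (hKM t ht) (hqB t ht) (norm_nonneg _) (by linarith)
  have h6 : M * B * ‖ξ - s‖ ≤ M * B * h := by
    gcongr
    rw [Real.norm_of_nonneg (by linarith [hξ.1])]
    linarith [hξ.2]
  rw [Real.norm_eq_abs] at h5
  rw [dist_zero_right, Real.norm_eq_abs]
  have h7 := abs_sub_abs_le_abs_sub (G s) (G ξ)
  rw [abs_sub_comm] at h7
  linarith

/-- The flux `Q - (k - 2) P + β m W P` of the autonomous equation is nonnegative when the solution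
is less singular than the fundamental solution at `-∞`. -/
theorem flux_nonneg {P Q W : ℝ → ℝ} {m b β k ν : ℝ} (hm0 : 0 < m)
    (hβ : 0 < β) (hk : 2 < k) (hkν : k < ν) (hbβ : b < (ν - k) * β)
    (hP0 : ∀ s, 0 < P s) (hW0 : ∀ s, 0 < W s)
    (hP : ∀ s, HasDerivAt P (Q s) s)
    (hW : ∀ s, HasDerivAt W ((1 - m) / m * W s * Q s / P s) s)
    (hQ : ∀ s, HasDerivAt Q (-(ν + 2 - 2 * k + β * W s) * Q s
      - P s * (b * m * W s - (k - 2) * (ν - k))) s)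
    (hlim : Tendsto (fun s => exp ((ν - k) * s) * P s) atBot (nhds 0)) (s₀ : ℝ) :
    0 ≤ Q s₀ - (k - 2) * P s₀ + β * m * W s₀ * P s₀ := by
  have hH : ∀ s, HasDerivAt
      (fun t => exp ((ν - k) * t) * (Q t - (k - 2) * P t + β * m * (W t * P t)))
      (exp ((ν - k) * s) * (((ν - k) * β - b) * (m * W s * P s))) s := by
    intro s
    refine ((hasDerivAt_exp_const_mul (ν - k) s).mul (((hQ s).sub ((hP s).const_mul (k - 2))).add
      (((hW s).mul (hP s)).const_mul (β * m)))).congr_deriv ?_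
    have := (hP0 s).ne'
    simp only [Pi.add_apply, Pi.sub_apply, Pi.mul_apply]
    field_simp
    ring
  have hmono : Monotone
      (fun t => exp ((ν - k) * t) * (Q t - (k - 2) * P t + β * m * (W t * P t))) := by
    refine monotone_of_deriv_nonneg (fun s => (hH s).differentiableAt) fun s => ?_
    rw [(hH s).deriv]
    have h1 := hP0 s
    have h2 := hW0 s
    have h3 : 0 < (ν - k) * β - b := by linarith
    positivity
  by_contra! hneg
  set δ : ℝ := -(exp ((ν - k) * s₀) * (Q s₀ - (k - 2) * P s₀ + β * m * (W s₀ * P s₀))) with hδ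
  have hδ0 : 0 < δ := by
    have := mul_neg_of_pos_of_neg (exp_pos ((ν - k) * s₀)) hneg
    rw [hδ]
    linarith
  have hν : 0 < ν - 2 := by linarith
  have hR : ∀ s, HasDerivAt
      (fun t => exp (-(k - 2) * t) * P t - δ / (ν - 2) * exp (-(ν - 2) * t))
      (exp (-(k - 2) * s) * (Q s - (k - 2) * P s) + δ * exp (-(ν - 2) * s)) s := by
    intro s
    refine (((hasDerivAt_exp_const_mul (-(k - 2)) s).mul (hP s)).sub
      ((hasDerivAt_exp_const_mul (-(ν - 2)) s).const_mul (δ / (ν - 2)))).congr_deriv ?_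
    field_simp
    ring
  have hanti : AntitoneOn
      (fun t => exp (-(k - 2) * t) * P t - δ / (ν - 2) * exp (-(ν - 2) * t)) (Iic s₀) := by
    refine antitoneOn_of_deriv_nonpos (convex_Iic s₀)
      (fun s _ => (hR s).continuousAt.continuousWithinAt)
      (fun s _ => (hR s).differentiableAt.differentiableWithinAt) fun s hs => ?_
    rw [interior_Iic] at hs
    rw [(hR s).deriv]
    have h1 : exp ((ν - k) * s) * (Q s - (k - 2) * P s + β * m * (W s * P s)) ≤ -δ := by
      simpa [hδ] using hmono (le_of_lt hs)
    have h2 : 0 < β * m * (W s * P s) := by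
      have h1 := hP0 s
      have h2 := hW0 s
      positivity
    have h3 : exp ((ν - k) * s) * (Q s - (k - 2) * P s) + δ ≤ 0 := by
      nlinarith [exp_pos ((ν - k) * s)]
    have h4 : exp (-(k - 2) * s) = exp (-(ν - 2) * s) * exp ((ν - k) * s) := by
      rw [← exp_add]; ring_nf
    rw [h4]
    nlinarith [exp_pos (-(ν - 2) * s)]
  set C : ℝ := exp (-(k - 2) * s₀) * P s₀ - δ / (ν - 2) * exp (-(ν - 2) * s₀) with hC
  have hlower : ∀ s ≤ s₀, δ / (ν - 2) + C * exp ((ν - 2) * s) ≤ exp ((ν - k) * s) * P s := by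
    intro s hs
    have h1 : C ≤ exp (-(k - 2) * s) * P s - δ / (ν - 2) * exp (-(ν - 2) * s) :=
      hanti (mem_Iic.mpr hs) (mem_Iic.mpr le_rfl) hs
    have h2 := mul_le_mul_of_nonneg_right h1 (exp_pos ((ν - 2) * s)).le
    have h4 : exp ((ν - k) * s) = exp (-(k - 2) * s) * exp ((ν - 2) * s) := by
      rw [← exp_add]; ring_nf
    have h5 : exp (-(ν - 2) * s) * exp ((ν - 2) * s) = 1 := by
      rw [← exp_add]; ring_nf; exact exp_zero
    rw [h4]
    linear_combination h2 - δ / (ν - 2) * h5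
  have hlim' : Tendsto (fun s => δ / (ν - 2) + C * exp ((ν - 2) * s)) atBot
      (nhds (δ / (ν - 2) + C * 0)) :=
    ((tendsto_exp_atBot.comp (tendsto_id.const_mul_atBot hν)).const_mul C).const_add _
  have := le_of_tendsto_of_tendsto hlim' hlim
    ((eventually_le_atBot s₀).mono fun s hs => hlower s hs)
  have h0 : 0 < δ / (ν - 2) := by positivity
  linarith

/-- Nonnegative flux forces `W` to be eventually bounded below, by logistic comparison. -/
theorem eventually_le_of_flux_nonneg {P Q W : ℝ → ℝ} {m β k : ℝ} (hm0 : 0 < m) (hm1 : m < 1)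
    (hβ : 0 < β) (hkm : k * (1 - m) = 2)
    (hP0 : ∀ s, 0 < P s) (hW0 : ∀ s, 0 < W s)
    (hW : ∀ s, HasDerivAt W ((1 - m) / m * W s * Q s / P s) s)
    (hflux : ∀ s, 0 ≤ Q s - (k - 2) * P s + β * m * W s * P s) :
    ∀ᶠ s in atTop, (k - 1) / β ≤ W s := by
  have hk : 2 < k := by nlinarith
  have hZ : ∀ s, HasDerivAt (fun t => ((W t)⁻¹ - β / k) * exp (2 * t))
      (-(exp (2 * s) * ((1 - m) / (m * W s * P s)
        * (Q s - (k - 2) * P s + β * m * W s * P s)))) s := by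
    intro s
    refine ((((hW s).inv (hW0 s).ne').sub_const (β / k)).mul (hasDerivAt_exp_const_mul 2 s)).congr_deriv ?_
    have h1 := (hP0 s).ne'
    have h2 := (hW0 s).ne'
    have h3 : k ≠ 0 := by positivity
    have h4 : 1 - m ≠ 0 := by linarith
    have h5 : k = 2 / (1 - m) := by rw [← hkm]; field_simp
    simp only [Pi.inv_apply]
    subst h5
    field_simp
    ring
  have hanti : Antitone (fun t => ((W t)⁻¹ - β / k) * exp (2 * t)) := by
    refine antitone_of_deriv_nonpos (fun s => (hZ s).differentiableAt) fun s => ?_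
    rw [(hZ s).deriv]
    have h1 := hP0 s
    have h2 := hW0 s
    have h3 := hflux s
    have h4 : 0 < 1 - m := by linarith
    have : 0 ≤ exp (2 * s) * ((1 - m) / (m * W s * P s)
        * (Q s - (k - 2) * P s + β * m * W s * P s)) := by positivity
    linarith
  set C : ℝ := ((W 0)⁻¹ - β / k) * exp (2 * 0) with hC
  have hlim : Tendsto (fun s => β / k + C * exp (-(2 * s))) atTop (nhds (β / k + C * 0)) :=
    ((tendsto_exp_neg_atTop_nhds_zero.comp
      (tendsto_id.const_mul_atTop two_pos)).const_mul C).const_add _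
  have hlt : β / k + C * 0 < β / (k - 1) := by
    rw [mul_zero, add_zero]
    exact div_lt_div_of_pos_left hβ (by linarith) (by linarith)
  filter_upwards [hlim.eventually_lt_const hlt, eventually_ge_atTop 0] with s hs hs0
  have h1 : ((W s)⁻¹ - β / k) * exp (2 * s) ≤ C := hanti hs0
  have h2 := mul_le_mul_of_nonneg_right h1 (exp_pos (-(2 * s))).le
  rw [mul_assoc, ← exp_add, add_neg_cancel, exp_zero, mul_one] at h2
  have h3 : (W s)⁻¹ ≤ β / (k - 1) := by linarith
  have := inv_anti₀ (inv_pos.mpr (hW0 s)) h3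
  rwa [inv_inv, inv_div] at this

/-- Positive solutions of the autonomous equation that are less singular than the fundamental
solution at `-∞` converge to the positive equilibrium at `+∞`. -/
theorem tendsto_equilibrium {P Q : ℝ → ℝ} {m b β k ν : ℝ} (hm0 : 0 < m) (hm1 : m < 1)
    (hβ : 0 < β) (hkm : k * (1 - m) = 2) (hkν : k < ν) (hb : 0 < b) (hbβ : b < (ν - k) * β)
    (hP0 : ∀ s, 0 < P s) (hP : ∀ s, HasDerivAt P (Q s) s)
    (hQ : ∀ s, HasDerivAt Q (-(ν + 2 - 2 * k + β * (m * P s) ^ ((1 - m) / m)) * Q s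
      - P s * (b * m * (m * P s) ^ ((1 - m) / m) - (k - 2) * (ν - k))) s)
    (hlim : Tendsto (fun s => exp ((ν - k) * s) * P s) atBot (nhds 0)) :
    Tendsto (fun s => (m * P s) ^ ((1 - m) / m)) atTop
      (nhds ((k - 2) * (ν - k) / (b * m))) := by
  have hk : 2 < k := by nlinarith
  have h1m : 0 < 1 - m := by linarith
  set γ : ℝ := (1 - m) / m with hγ
  have hγ0 : 0 < γ := by positivity
  have hγm : (γ + 1) * m = 1 := by rw [hγ]; field_simp; ring
  set c : ℝ := (k - 2) * (ν - k) with hc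
  have hc0 : 0 < c := mul_pos (by linarith) (by linarith)
  set W : ℝ → ℝ := fun s => (m * P s) ^ γ with hWdef
  have hmP : ∀ s, 0 < m * P s := fun s => mul_pos hm0 (hP0 s)
  have hW0 : ∀ s, 0 < W s := fun s => rpow_pos_of_pos (hmP s) γ
  have hW : ∀ s, HasDerivAt W (γ * W s * Q s / P s) s := by
    intro s
    refine (((hP s).const_mul m).rpow_const (p := γ) (Or.inl (hmP s).ne')).congr_deriv ?_
    rw [rpow_sub_one (hmP s).ne']
    have := (hP0 s).ne'
    simp only [hWdef]
    field_simp
  have hflux := flux_nonneg hm0 hβ hk hkν hbβ hP0 hW0 hP hW hQ hlim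
  obtain ⟨S, hS⟩ := eventually_atTop.mp
    (eventually_le_of_flux_nonneg hm0 hm1 hβ hkm hP0 hW0 hW hflux)
  have hPW : ∀ s, m * P s = W s ^ γ⁻¹ := fun s => (rpow_rpow_inv (hmP s).le hγ0.ne').symm
  have hD : ∀ s, S ≤ s → 1 ≤ ν + 2 - 2 * k + β * W s := by
    intro s hs
    have := (div_le_iff₀ hβ).mp (hS s hs)
    linarith
  set V : ℝ → ℝ := fun s => P s ^ 2 * (b * m / (γ + 2) * W s - c / 2) with hVdef
  have hV : ∀ s, HasDerivAt V (P s * (b * m * W s - c) * Q s) s := by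
    intro s
    refine (((hP s).pow 2).mul (((hW s).const_mul (b * m / (γ + 2))).sub_const (c / 2))).congr_deriv
      ?_
    have := (hP0 s).ne'
    have : γ + 2 ≠ 0 := by positivity
    simp only [Pi.pow_apply]
    field_simp
    ring
  have hG : ∀ s, HasDerivAt (fun t => P t * (b * m * W t - c)) ((b * W s - c) * Q s) s := by
    intro s
    refine ((hP s).mul (((hW s).const_mul (b * m)).sub_const c)).congr_deriv ?_
    have := (hP0 s).ne'
    field_simp
    linear_combination b * W s * Q s * hγm
  have hE : ∀ s, HasDerivAt (fun t => Q t ^ 2 / 2 + V t)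
      (-(ν + 2 - 2 * k + β * W s) * Q s ^ 2) s := fun s =>
    ((((hQ s).pow 2).div_const 2).add (hV s)).congr_deriv (by simp; ring)
  have hEanti : AntitoneOn (fun t => Q t ^ 2 / 2 + V t) (Ici S) := by
    refine antitoneOn_of_deriv_nonpos (convex_Ici S)
      (fun s _ => (hE s).continuousAt.continuousWithinAt)
      (fun s _ => (hE s).differentiableAt.differentiableWithinAt) fun s hs => ?_
    rw [interior_Ici] at hs
    rw [(hE s).deriv]
    nlinarith [hD s (le_of_lt hs), sq_nonneg (Q s)]
  set E₀ : ℝ := Q S ^ 2 / 2 + V S with hE₀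
  have hVE : ∀ s, S ≤ s → V s ≤ E₀ := by
    intro s hs
    have := hEanti self_mem_Ici (mem_Ici.mpr hs) hs
    simp only at this
    nlinarith [sq_nonneg (Q s)]
  obtain ⟨B, hB0, hPB, hWB⟩ : ∃ B, 0 < B ∧ (∀ s, S ≤ s → P s ≤ B) ∧ ∀ s, S ≤ s → W s ≤ B := by
    set R : ℝ := (γ + 2) * (c / 2 + 1) / (b * m) with hR
    have hR0 : 0 < R := by positivity
    set T : ℝ := max R ((m * (|E₀| + 1)) ^ γ) with hT
    have hWT : ∀ s, S ≤ s → W s ≤ T := by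
      intro s hs
      rcases le_or_gt (W s) R with h | h
      · exact h.trans (le_max_left _ _)
      refine le_trans ?_ (le_max_right _ _)
      have h1 : c / 2 + 1 ≤ b * m / (γ + 2) * W s := by
        calc c / 2 + 1 = b * m / (γ + 2) * R := by rw [hR]; field_simp
          _ ≤ _ := by gcongr
      have h2 : P s ^ 2 ≤ V s := by
        simp only [hVdef]
        nlinarith [sq_nonneg (P s)]
      have h3 : P s ≤ |E₀| + 1 := by
        have h4 := hVE s hs
        have h5 := le_abs_self E₀
        nlinarith [hP0 s, abs_nonneg E₀]
      have := hP0 s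
      simp only [hWdef]
      gcongr
    refine ⟨max T (T ^ γ⁻¹ / m), lt_max_of_lt_left (lt_max_of_lt_left hR0), fun s hs => ?_,
      fun s hs => (hWT s hs).trans (le_max_left _ _)⟩
    refine le_trans ?_ (le_max_right _ _)
    rw [le_div_iff₀ hm0, mul_comm, hPW s]
    exact rpow_le_rpow (hW0 s).le (hWT s hs) (by positivity)
  have hAbs : ∀ s, S ≤ s → ∀ a, 0 < a → |a * W s - c| ≤ a * B + c := by
    intro s hs a ha
    have h1 := mul_le_mul_of_nonneg_left (hWB s hs) ha.le
    have h2 := mul_pos ha (hW0 s)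
    rw [abs_le]
    constructor <;> nlinarith
  set M : ℝ := |ν + 2 - 2 * k| + β * B + B * (b * m * B + c) + (b * B + c) + B ^ 2 * (c / 2) with hM
  have hGlim : Tendsto (fun t => P t * (b * m * W t - c)) atTop (nhds 0) := by
    have t1 : 0 < β * B := by positivity
    have t2 : 0 < B * (b * m * B + c) := by positivity
    have t3 : 0 < b * B + c := by positivity
    have t4 : 0 < B ^ 2 * (c / 2) := by positivity
    have t5 := abs_nonneg (ν + 2 - 2 * k)
    refine tendsto_force_zero_of_damped (S := S) (M := M) hQ hV hG hD ?_ ?_ ?_ ?_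
    · intro s hs
      have := mul_le_mul_of_nonneg_left (hWB s hs) hβ.le
      have := le_abs_self (ν + 2 - 2 * k)
      linarith
    · intro s hs
      have : |P s * (b * m * W s - c)| ≤ B * (b * m * B + c) := by
        rw [abs_mul, abs_of_pos (hP0 s)]
        exact mul_le_mul (hPB s hs) (hAbs s hs _ (by positivity)) (abs_nonneg _) hB0.le
      linarith
    · intro s hs
      have := hAbs s hs b hb
      linarith
    · intro s hs
      have h1 : P s ^ 2 ≤ B ^ 2 := by
        have := hP0 s
        have := hPB s hs
        gcongr
      have h2 : 0 < P s ^ 2 * (b * m / (γ + 2) * W s) := by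
        have := hP0 s
        have := hW0 s
        positivity
      have h3 := mul_le_mul_of_nonneg_right h1 (by positivity : 0 ≤ c / 2)
      simp only [hVdef]
      nlinarith
  set p₀ : ℝ := ((k - 1) / β) ^ γ⁻¹ / m with hp₀
  have hk1 : 0 < (k - 1) / β := div_pos (by linarith) hβ
  have hp₀pos : 0 < p₀ := by positivity
  have hPp₀ : ∀ s, S ≤ s → p₀ ≤ P s := by
    intro s hs
    rw [hp₀, div_le_iff₀ hm0, mul_comm (P s), hPW s]
    exact rpow_le_rpow hk1.le (hS s hs) (by positivity)
  have hWlim : Tendsto (fun s => b * m * W s - c) atTop (nhds 0) := by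
    refine squeeze_zero_norm' ?_ (by simpa using hGlim.norm.div_const p₀)
    filter_upwards [eventually_ge_atTop S] with s hs
    rw [le_div_iff₀ hp₀pos, abs_of_pos (hP0 s), mul_comm]
    exact mul_le_mul_of_nonneg_right (hPp₀ s hs) (norm_nonneg _)
  have hbm : 0 < b * m := by positivity
  have := (hWlim.add_const c).div_const (b * m)
  rw [zero_add] at this
  refine this.congr fun s => ?_
  field_simp
  ring

theorem stmt17 (n : ℕ) (m ρ1 η β α β1 : ℝ)
    (hn : 3 ≤ n) (hm0 : 0 < m) (hm1 : m < ((n : ℝ) - 2) / (n : ℝ))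
    (hρ1 : 0 < ρ1) (hη : 0 < η)
    (hβ : m * ρ1 / ((n : ℝ) - 2 - (n : ℝ) * m) < β)
    (hα : α = (2 * β + ρ1) / (1 - m))
    (hβ1 : β1 = ρ1 / ((n : ℝ) - 2 - (n : ℝ) * m))
    (hββ1 : β1 < β)
    (f : ℝ → ℝ) (hf : FDESol n m α β η f) :
    Filter.Tendsto (fun r => r ^ 2 * f r ^ (1 - m)) Filter.atTop
      (nhds (2 * ((n : ℝ) - 2 - (n : ℝ) * m) / ((1 - m) * ρ1))) := by
  obtain ⟨hf0, hF2, hode, hlim0⟩ := hf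
  have hn' : (3 : ℝ) ≤ n := by exact_mod_cast hn
  have hnm : 0 < (n : ℝ) - 2 - n * m := by
    rw [lt_div_iff₀ (by linarith)] at hm1
    linarith
  have h1m : 0 < 1 - m := by nlinarith
  have hβ0 : 0 < β := lt_trans (by positivity) hβ
  rw [div_lt_iff₀ hnm] at hβ
  rw [hβ1, div_lt_iff₀ hnm] at hββ1
  set k : ℝ := 2 / (1 - m) with hk
  set b : ℝ := ρ1 / (1 - m) with hb
  have hkm : k * (1 - m) = 2 := by rw [hk]; field_simp
  have hnk : (n : ℝ) - k = (n - 2 - n * m) / (1 - m) := by rw [hk]; field_simp; ring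
  have hnk0 : 0 < (n : ℝ) - k := by rw [hnk]; positivity
  have hαb : α = b + β * k := by rw [hα, hb, hk]; field_simp; ring
  have hb0 : 0 < b := by positivity
  have hbβ : b < (n - k) * β := by
    rw [hnk, hb, div_mul_eq_mul_div]
    gcongr
    linarith
  set F : ℝ → ℝ := fun r => f r ^ m / m with hF
  have hF1 : ∀ r, 0 < r → HasDerivAt F (deriv F r) r := fun r hr =>
    ((hF2.differentiableOn (by norm_num)).differentiableAt (Ioi_mem_nhds hr)).hasDerivAt
  have hF1' : ∀ r, 0 < r → HasDerivAt (deriv F) (deriv (deriv F) r) r := fun r hr =>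
    (((hF2.deriv_of_isOpen (m := 1) isOpen_Ioi (by norm_num)).differentiableOn
      (by norm_num)).differentiableAt (Ioi_mem_nhds hr)).hasDerivAt
  have hF0 : ∀ r, 0 < r → 0 < F r := fun r hr => div_pos (rpow_pos_of_pos (hf0 r hr) m) hm0
  have hfF : ∀ r, 0 < r → f r = (m * F r) ^ m⁻¹ := by
    intro r hr
    simp only [hF]
    rw [mul_div_cancel₀ _ hm0.ne', rpow_rpow_inv (hf0 r hr).le hm0.ne']
  have hderivf : ∀ r, 0 < r → deriv f r = f r ^ (1 - m) * deriv F r := by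
    intro r hr
    have h1 : f =ᶠ[nhds r] fun t => (m * F t) ^ m⁻¹ := by
      filter_upwards [Ioi_mem_nhds hr] with t ht using hfF t ht
    have h2 := (((hF1 r hr).const_mul m).rpow_const (p := m⁻¹)
      (Or.inl (mul_pos hm0 (hF0 r hr)).ne')).deriv
    rw [h1.deriv_eq, h2, hfF r hr, ← rpow_mul (mul_pos hm0 (hF0 r hr)).le]
    have : m⁻¹ * (1 - m) = m⁻¹ - 1 := by field_simp
    rw [this]
    field_simp
  set P : ℝ → ℝ := fun s => exp ((k - 2) * s) * F (exp s) with hPdef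
  set Q : ℝ → ℝ := fun s => (k - 2) * P s + exp ((k - 1) * s) * deriv F (exp s) with hQdef
  have hP0 : ∀ s, 0 < P s := fun s => mul_pos (exp_pos _) (hF0 _ (exp_pos s))
  have hexp1 : ∀ s, exp ((k - 1) * s) = exp ((k - 2) * s) * exp s := fun s => by
    rw [← exp_add]; ring_nf
  have hP : ∀ s, HasDerivAt P (Q s) s := by
    intro s
    refine ((hasDerivAt_exp_const_mul (k - 2) s).mul
      ((hF1 _ (exp_pos s)).comp s (Real.hasDerivAt_exp s))).congr_deriv ?_
    simp only [hQdef, hPdef, hexp1, Function.comp]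
    ring
  have hmP : ∀ s, m * P s = (exp s ^ k * f (exp s)) ^ m := by
    intro s
    have h1 := hf0 _ (exp_pos s)
    rw [mul_rpow (by positivity) h1.le, ← rpow_mul (exp_pos s).le, ← exp_mul]
    simp only [hPdef, hF]
    have h2 : s * (k * m) = (k - 2) * s := by linear_combination -s * hkm
    rw [h2]
    field_simp
  have hW : ∀ s, (m * P s) ^ ((1 - m) / m) = exp s ^ 2 * f (exp s) ^ (1 - m) := by
    intro s
    have h1 := hf0 _ (exp_pos s)
    rw [hmP, ← rpow_mul (by positivity), mul_div_cancel₀ _ hm0.ne',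
      mul_rpow (by positivity) h1.le, ← rpow_mul (exp_pos s).le, hkm, rpow_two]
  have hφ : ∀ s, exp (k * s) * f (exp s) = m * P s * (exp s ^ 2 * f (exp s) ^ (1 - m)) := by
    intro s
    have h1 := hf0 _ (exp_pos s)
    have h2 : f (exp s) = f (exp s) ^ m * f (exp s) ^ (1 - m) := by
      rw [← rpow_add h1, add_sub_cancel, rpow_one]
    have h3 : exp (k * s) = exp ((k - 2) * s) * exp s ^ 2 := by
      rw [← exp_nat_mul, ← exp_add]; push_cast; ring_nf
    have h4 : m * P s = exp ((k - 2) * s) * f (exp s) ^ m := by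
      simp only [hPdef, hF]; field_simp
    rw [h4, h3]
    linear_combination exp ((k - 2) * s) * exp s ^ 2 * h2
  have hQ : ∀ s, HasDerivAt Q (-(n + 2 - 2 * k + β * (m * P s) ^ ((1 - m) / m)) * Q s
      - P s * (b * m * (m * P s) ^ ((1 - m) / m) - (k - 2) * (n - k))) s := by
    intro s
    refine (((hP s).const_mul (k - 2)).add ((hasDerivAt_exp_const_mul (k - 1) s).mul
      ((hF1' _ (exp_pos s)).comp s (Real.hasDerivAt_exp s)))).congr_deriv ?_
    have h1 := hode _ (mem_Ioi.mpr (exp_pos s))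
    rw [hderivf _ (exp_pos s)] at h1
    have h2 := hφ s
    rw [hW]
    simp only [Function.comp]
    have h3 : exp (k * s) = exp ((k - 1) * s) * exp s := by
      rw [← exp_add]; ring_nf
    have h4 : (n - 1) / exp s * exp s = (n : ℝ) - 1 := div_mul_cancel₀ _ (exp_pos s).ne'
    rw [h3] at h2
    have h5 : Q s = (k - 2) * P s + exp ((k - 1) * s) * deriv F (exp s) := rfl
    set w := f (exp s) ^ (1 - m)
    rw [hαb] at h1
    rw [h5]
    linear_combination exp ((k - 1) * s) * exp s * h1 - exp ((k - 1) * s) * deriv F (exp s) * h4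
      - (b + β * k) * h2 + β * exp s ^ 2 * w * P s * hkm
  have hlimP : Tendsto (fun s => exp ((n - k) * s) * P s) atBot (nhds 0) := by
    have h1 : Tendsto exp atBot (nhdsWithin 0 (Ioi 0)) := tendsto_exp_atBot_nhdsGT
    have h2 := ((hlim0.comp h1).rpow_const (p := m) (Or.inl hη.ne')).div_const m
    have hpos : 0 < n - 2 - m * (α / β) := by
      have : n - 2 - m * (α / β) = (β * (n - 2 - n * m) - m * ρ1) / ((1 - m) * β) := by
        rw [hα]; field_simp; ring
      rw [this]
      exact div_pos (by linarith) (by positivity)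
    have h3 : Tendsto (fun s => exp ((n - 2 - m * (α / β)) * s)) atBot (nhds 0) :=
      tendsto_exp_atBot.comp (tendsto_id.const_mul_atBot hpos)
    have h4 := h3.mul h2
    rw [zero_mul] at h4
    refine h4.congr fun s => ?_
    have h5 := hf0 _ (exp_pos s)
    simp only [Function.comp, hPdef, hF]
    rw [mul_rpow (by positivity) h5.le, ← rpow_mul (exp_pos s).le, ← exp_mul, mul_div_assoc,
      ← mul_assoc, ← exp_add, ← mul_assoc (exp ((n - k) * s)), ← exp_add]
    ring_nf
  have hmain := tendsto_equilibrium hm0 (by linarith) hβ0 hkm (by linarith) hb0 hbβ hP0 hP hQ hlimP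
  have hval : (k - 2) * (n - k) / (b * m) = 2 * ((n : ℝ) - 2 - n * m) / ((1 - m) * ρ1) := by
    rw [hnk, hb, hk]; field_simp; ring
  rw [hval] at hmain
  refine (hmain.comp tendsto_log_atTop).congr' ?_
  filter_upwards [eventually_gt_atTop 0] with r hr
  simp only [Function.comp, hW, exp_log hr]
end

section
/- Set β1 = ρ1/(n-2-nm) and assume mρ1/(n-2-nm) < β ≤ β1. Let f be a positive function on (0,∞) such that r ↦ f(r)^m/m is twice continuously differentiable on (0,∞), (f^m/m)''(r) + ((n-1)/r)·(f^m/m)'(r) + α·f(r) + β·r·f'(r) = 0 for all r > 0, lim_{r→0+} r^{α/β}·f(r) = η, and, with w(r) = r^{α/β}·f(r) and z(s) = e^s·w'(e^s)/w(e^s), 0 < z(s)·e^{-(ρ1/β)s} ≤ C4·η^{m-1} for all s ∈ ℝ. Then there exists a constant C6 > 0 such that r²·f(r)^{1-m} ≥ C6 for all r ≥ 1. -/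
open Real Set Filter

/-- `z(s) = e^s w'(e^s) / w(e^s)` where `w(r) = r^{α/β} f(r)`. -/
noncomputable def Zfun (α β : ℝ) (f : ℝ → ℝ) (s : ℝ) : ℝ :=
  Real.exp s * deriv (fun r => r ^ (α / β) * f r) (Real.exp s) /
    (Real.exp s ^ (α / β) * f (Real.exp s))

/-- the bound `0 < z(s) e^{-(ρ1/β) s} ≤ C4 η^{m-1}` for all `s ∈ ℝ`. -/
def FDEZBound (m α β ρ1 η C4 : ℝ) (f : ℝ → ℝ) : Prop :=
  ∀ s : ℝ, 0 < Zfun α β f s * Real.exp (-(ρ1 / β) * s) ∧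
    Zfun α β f s * Real.exp (-(ρ1 / β) * s) ≤ C4 * η ^ (m - 1)

/-- An inequality `h ≤ g` at the left end point propagates forward if `g` increases strictly
whenever it equals `h`. -/
theorem le_of_hasDerivAt_pos_of_eq {g g' : ℝ → ℝ} {h s₀ s : ℝ}
    (hg : ∀ t, HasDerivAt g (g' t) t) (h₀ : h ≤ g s₀)
    (hpos : ∀ t, g t = h → 0 < g' t) (hs : s₀ ≤ s) : h ≤ g s := by
  have key := image_le_of_deriv_right_lt_deriv_boundary
    (f := fun t => -g t) (f' := fun t => -g' t) (a := s₀) (b := s)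
    (B := fun _ => -h) (B' := fun _ => 0)
    (fun t _ => (hg t).neg.continuousAt.continuousWithinAt)
    (fun t _ => (hg t).neg.hasDerivWithinAt) (neg_le_neg h₀)
    (fun t => hasDerivAt_const t (-h))
    (fun t _ ht => neg_neg_of_pos (hpos t (neg_injective ht)))
    (right_mem_Icc.2 hs)
  exact neg_le_neg_iff.1 key

/-- A solution of `z' = m (a - z) (z + c) - β e^y z` which tends to `0` at `-∞` stays below `a`. -/
theorem le_of_tendsto_zero_atBot {m a c β : ℝ} {y z : ℝ → ℝ}
    (ha : 0 < a) (hβ : 0 < β)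
    (hz' : ∀ s, HasDerivAt z (m * (a - z s) * (z s + c) - β * exp (y s) * z s) s)
    (hlim : Tendsto z atBot (nhds 0)) (s : ℝ) : z s ≤ a := by
  obtain ⟨t, hta, hts⟩ := ((hlim.eventually (gt_mem_nhds ha)).and (eventually_le_atBot s)).exists
  refine neg_le_neg_iff.1 (le_of_hasDerivAt_pos_of_eq (g := fun t => -z t)
    (fun t => (hz' t).neg) (neg_le_neg hta.le) (fun t ht => ?_) hts)
  rw [neg_injective ht]
  have : 0 < β * exp (y t) * a := by positivity
  linarith

/-- In the autonomous system `y' = p (z - b)`, `z' = m (a - z) (z + c) - β e^y z` with `b < a`,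
the component `y` is bounded below on `[0, ∞)`: the quantity `y + p / (m c) * z` increases as
long as it is sufficiently negative. -/
theorem exists_lower_bound_of_system {m p a b c β : ℝ} {y z : ℝ → ℝ}
    (hm : 0 < m) (hp : 0 < p) (ha : 0 < a) (hba : b < a) (hc : 0 < c) (hβ : 0 < β)
    (hy' : ∀ s, HasDerivAt y (p * (z s - b)) s)
    (hz' : ∀ s, HasDerivAt z (m * (a - z s) * (z s + c) - β * exp (y s) * z s) s)
    (hz : ∀ s, 0 < z s) (hlim : Tendsto z atBot (nhds 0)) :
    ∃ y₀, ∀ s, 0 ≤ s → y₀ ≤ y s := by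
  have hza := le_of_tendsto_zero_atBot ha hβ hz' hlim
  set K := p / (m * c) with hK
  have hK0 : 0 < K := by positivity
  have hKmc : K * (m * c) = p := by rw [hK]; field_simp
  set ε := p * (a - b) / (2 * (K * β * a)) with hε
  have hab : 0 < a - b := sub_pos.2 hba
  have hε0 : 0 < ε := by positivity
  have hεK : 2 * (K * β * a * ε) = p * (a - b) := by rw [hε]; field_simp
  set h := min (y 0 + K * z 0) (log ε)
  refine ⟨h - K * a, fun s hs => ?_⟩
  have key : h ≤ y s + K * z s := by
    refine le_of_hasDerivAt_pos_of_eq (g := fun t => y t + K * z t)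
      (fun t => (hy' t).add ((hz' t).const_mul K)) (min_le_left _ _) (fun t ht => ?_) hs
    have hzt := hz t
    have hexp : exp (y t) ≤ ε := by
      rw [← exp_log hε0]
      refine exp_le_exp.2 ((le_add_of_nonneg_right (by positivity)).trans
        (ht.le.trans (min_le_right _ _)))
    have h1 : K * (β * exp (y t) * z t) ≤ K * β * a * ε := by
      calc K * (β * exp (y t) * z t) ≤ K * (β * ε * a) := by gcongr; exact hza t
        _ = K * β * a * ε := by ring
    have h2 : 0 ≤ K * (m * (a - z t) * z t) := by
      have := sub_nonneg.2 (hza t)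
      positivity
    have h3 : 0 < p * (a - b) := by positivity
    linear_combination h1 + h2 + h3 / 2 + hεK / 2 - (a - z t) * hKmc
  have : K * z s ≤ K * a := by gcongr; exact hza s
  linarith

namespace FDESol

variable {n : ℕ} {m α β η : ℝ} {f : ℝ → ℝ}

theorem hasDerivAt_rpow_div (hf : FDESol n m α β η f) {r : ℝ} (hr : 0 < r) :
    HasDerivAt (fun r => f r ^ m / m) (deriv (fun r => f r ^ m / m) r) r :=
  ((hf.2.1.differentiableOn (by norm_num)).differentiableAt (Ioi_mem_nhds hr)).hasDerivAt

theorem hasDerivAt_deriv_rpow_div (hf : FDESol n m α β η f) {r : ℝ} (hr : 0 < r) :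
    HasDerivAt (deriv fun r => f r ^ m / m) (deriv (deriv fun r => f r ^ m / m) r) r :=
  (((hf.2.1.deriv_of_isOpen isOpen_Ioi (m := 1) (by norm_num)).differentiableOn
    (by norm_num)).differentiableAt (Ioi_mem_nhds hr)).hasDerivAt

theorem hasDerivAt (hf : FDESol n m α β η f) (hm : 0 < m) {r : ℝ} (hr : 0 < r) :
    HasDerivAt f (deriv f r) r := by
  have h := ((hf.hasDerivAt_rpow_div hr).const_mul m).rpow_const (p := m⁻¹)
    (Or.inl (mul_ne_zero hm.ne' (div_ne_zero (rpow_pos_of_pos (hf.1 r hr) m).ne' hm.ne')))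
  refine (h.differentiableAt.congr_of_eventuallyEq ?_).hasDerivAt
  filter_upwards [Ioi_mem_nhds hr] with x hx
  rw [mul_div_cancel₀ _ hm.ne', rpow_rpow_inv (hf.1 x hx).le hm.ne']

theorem deriv_rpow_div (hf : FDESol n m α β η f) (hm : 0 < m) {r : ℝ} (hr : 0 < r) :
    deriv (fun r => f r ^ m / m) r = deriv f r * f r ^ (m - 1) := by
  rw [(((hf.hasDerivAt hm hr).rpow_const (p := m) (Or.inl (hf.1 r hr).ne')).div_const m).deriv]
  field_simp

theorem Zfun_eq (hf : FDESol n m α β η f) (hm : 0 < m) (s : ℝ) :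
    Zfun α β f s = α / β + exp s * deriv f (exp s) / f (exp s) := by
  have hr := exp_pos s
  have hfr := hf.1 _ hr
  have hpow := rpow_pos_of_pos hr (α / β)
  rw [Zfun, ((hasDerivAt_rpow_const (p := α / β) (Or.inl hr.ne')).fun_mul
    (hf.hasDerivAt hm hr)).deriv, rpow_sub_one hr.ne']
  generalize exp s ^ (α / β) = P at *
  generalize α / β = a at *
  field_simp

theorem hasDerivAt_log_comp_exp (hf : FDESol n m α β η f) (hm : 0 < m) (s : ℝ) :
    HasDerivAt (fun s => log (f (exp s))) (Zfun α β f s - α / β) s := by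
  have hr := exp_pos s
  refine (((hf.hasDerivAt hm hr).comp s (Real.hasDerivAt_exp s)).log
    (hf.1 _ hr).ne').congr_deriv ?_
  rw [hf.Zfun_eq hm, add_sub_cancel_left, Function.comp, mul_comm]

/-- In the variable `s = log r` the equation for `f` becomes a first order equation for `z`. -/
theorem hasDerivAt_Zfun (hf : FDESol n m α β η f) (hm : 0 < m) (hβ : β ≠ 0) (s : ℝ) :
    HasDerivAt (Zfun α β f)
      (-(m * (Zfun α β f s - α / β) ^ 2 + ((n : ℝ) - 2) * (Zfun α β f s - α / β))
        - β * exp (2 * s + (1 - m) * log (f (exp s))) * Zfun α β f s) s := by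
  have hr := exp_pos s
  have hfr := hf.1 _ hr
  have hfm := rpow_pos_of_pos hfr m
  have hZ : Zfun α β f = fun s =>
      α / β + exp s * deriv (fun r => f r ^ m / m) (exp s) / (m * (f (exp s) ^ m / m)) := by
    funext t
    have ht := exp_pos t
    have hft := hf.1 _ ht
    have hftm := rpow_pos_of_pos hft m
    rw [hf.Zfun_eq hm, hf.deriv_rpow_div hm ht, rpow_sub_one hft.ne']
    field_simp
  have hexp := Real.hasDerivAt_exp s
  have hd := (((hexp.mul ((hf.hasDerivAt_deriv_rpow_div hr).comp s hexp)).div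
    (((hf.hasDerivAt_rpow_div hr).comp s hexp).const_mul m)
    (mul_ne_zero hm.ne' (div_ne_zero hfm.ne' hm.ne'))).const_add (α / β))
  have hode := hf.2.2.1 _ hr
  have hv : exp (2 * s + (1 - m) * log (f (exp s)))
      = exp s ^ 2 * f (exp s) / f (exp s) ^ m := by
    rw [exp_add, two_mul, exp_add, mul_comm (1 - m), ← rpow_def_of_pos hfr, rpow_sub hfr,
      rpow_one]
    ring
  have hode' : deriv (deriv fun r => f r ^ m / m) (exp s) =
      -(((n : ℝ) - 1) / exp s * deriv (fun r => f r ^ m / m) (exp s) + α * f (exp s)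
        + β * exp s * deriv f (exp s)) := by linarith
  refine (hd.congr_of_eventuallyEq (.of_eq hZ)).congr_deriv ?_
  rw [hf.Zfun_eq hm, hv]
  simp only [Function.comp, Pi.mul_apply]
  rw [hode', hf.deriv_rpow_div hm hr, rpow_sub_one hfr.ne']
  generalize f (exp s) ^ m = P at *
  generalize deriv f (exp s) = D at *
  generalize f (exp s) = y at *
  generalize exp s = r at *
  field_simp
  ring

end FDESol

theorem FDEZBound.Zfun_pos {m α β ρ1 η C4 : ℝ} {f : ℝ → ℝ}
    (hz : FDEZBound m α β ρ1 η C4 f) (s : ℝ) : 0 < Zfun α β f s :=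
  pos_of_mul_pos_left (hz s).1 (exp_pos _).le

theorem FDEZBound.tendsto_Zfun_atBot {m α β ρ1 η C4 : ℝ} {f : ℝ → ℝ}
    (hz : FDEZBound m α β ρ1 η C4 f) (h : 0 < ρ1 / β) :
    Tendsto (Zfun α β f) atBot (nhds 0) := by
  have hlim : Tendsto (fun s => C4 * η ^ (m - 1) * exp (ρ1 / β * s)) atBot (nhds 0) := by
    simpa using (tendsto_exp_atBot.comp (tendsto_id.const_mul_atBot h)).const_mul
      (C4 * η ^ (m - 1))
  refine squeeze_zero (fun s => (hz.Zfun_pos s).le) (fun s => ?_) hlim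
  have h1 := (hz s).2
  rwa [neg_mul, exp_neg, ← div_eq_mul_inv, div_le_iff₀ (exp_pos _)] at h1

theorem stmt18 (n : ℕ) (m ρ1 η β α β1 C1 C2 C3 C4 : ℝ)
    (hn : 3 ≤ n) (hm0 : 0 < m) (hm1 : m < ((n : ℝ) - 2) / (n : ℝ))
    (hρ1 : 0 < ρ1) (hη : 0 < η)
    (hα : α = (2 * β + ρ1) / (1 - m))
    (hβ1 : β1 = ρ1 / ((n : ℝ) - 2 - (n : ℝ) * m))
    (hβlow : m * ρ1 / ((n : ℝ) - 2 - (n : ℝ) * m) < β)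
    (hβhigh : β ≤ β1)
    (hC1 : C1 = 1 / (2 * m) * ((n : ℝ) - 2 - 2 * m * α / β))
    (hC2 : C2 = α / β * ((n : ℝ) - 2 - m * α / β))
    (hC3 : C3 = C2 + m * C1 ^ 2)
    (hC4 : C4 = C3 / β)
    (f : ℝ → ℝ) (hf : FDESol n m α β η f) (hz : FDEZBound m α β ρ1 η C4 f) :
    ∃ C6 : ℝ, 0 < C6 ∧ ∀ r : ℝ, 1 ≤ r → C6 ≤ r ^ 2 * f r ^ (1 - m) := by
  have hn0 : (0 : ℝ) < n := by exact_mod_cast (by omega : 0 < n)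
  have hD : 0 < (n : ℝ) - 2 - n * m := by
    have := (lt_div_iff₀ hn0).1 hm1
    linarith
  have hm1' : 0 < 1 - m := by nlinarith
  have hβ : 0 < β := lt_trans (by positivity) hβlow
  have hlow : m * ρ1 < β * ((n : ℝ) - 2 - n * m) := (div_lt_iff₀ hD).1 hβlow
  have ha : 0 < α / β := by rw [hα]; positivity
  have haβ : (1 - m) * (α / β) = 2 + ρ1 / β := by rw [hα]; field_simp
  have hc : 0 < ((n : ℝ) - 2) / m - α / β := by
    rw [sub_pos, hα, div_div, div_lt_div_iff₀ (by positivity) hm0]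
    linarith
  have hba : ρ1 / ((1 - m) * β) < α / β := by
    rw [hα, div_div]
    gcongr
    linarith
  obtain ⟨y₀, hy₀⟩ := exists_lower_bound_of_system (p := 1 - m) (b := ρ1 / ((1 - m) * β))
    (y := fun s => 2 * s + (1 - m) * log (f (exp s))) (z := Zfun α β f) hm0 hm1' ha hba hc hβ
    (fun s => by
      refine (((hasDerivAt_id s).const_mul 2).add
        ((hf.hasDerivAt_log_comp_exp hm0 s).const_mul (1 - m))).congr_deriv ?_
      have : (1 - m) * (ρ1 / ((1 - m) * β)) = ρ1 / β := by field_simp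
      linear_combination this - haβ)
    (fun s => (hf.hasDerivAt_Zfun hm0 hβ.ne' s).congr_deriv (by
      have : m * (((n : ℝ) - 2) / m) = n - 2 := by field_simp
      linear_combination (Zfun α β f s - α / β) * this))
    hz.Zfun_pos (hz.tendsto_Zfun_atBot (by positivity))
  refine ⟨exp y₀, exp_pos _, fun r hr => ?_⟩
  have hr0 : 0 < r := by linarith
  have h := exp_le_exp.2 (hy₀ (log r) (log_nonneg hr))
  simp only [exp_log hr0] at h
  rwa [exp_add, two_mul, exp_add, exp_log hr0, mul_comm (1 - m), ← rpow_def_of_pos (hf.1 r hr0),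
    ← pow_two] at h
end
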